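/- arXiv:2006.11732 — 2 statements merged into one kernel-verified Lean document; each statement's English description precedes it below -/
import Mathlib

section
/- Every even superderivation D of SL^{n,m} is determined by at most n+3 parameters; explicitly there exist scalars a_1, a_3,...,a_n, b_2, b_3, d_n, p_1 such that D(t_1) = -b_3 x_1 + Σ_{k=2}^{n-1} k a_{k+1} x_k + n d_n x_n, D(t_2) = Σ_{k=2}^{n-1} a_{k+1} x_k + d_n x_n, D(t_3) = 0, D(x_1) = a_1 x_1 + Σ_{k=3}^n a_k x_k, D(x_2) = b_2 x_2 + b_3 x_3, D(x_i) = ((i-2)a_1 + b_2) x_i + b_3 x_{i+1} for 3 ≤ i ≤ n, D(y_1) = p_1 y_1 + b_3 y_2, D(y_j) = ((j-1)a_1 + p_1) y_j + b_3 y_{j+1} for 2 ≤ j ≤ m. Hence dim Der_0(SL^{n,m}) = n+3. -/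
namespace SolvableModelFiliform

/-- Index type of `SL^{n,m}`: `x`-indices, then `t`-indices, then `y`-indices (0-based). -/
abbrev Idx (n m : ℕ) := Fin n ⊕ (Fin 3 ⊕ Fin m)

/-- Underlying vector space over ℂ. -/
abbrev V (n m : ℕ) := Idx n m →₀ ℂ

/-- `X n m k` is the basis vector `x_k` (1-based), or `0` if out of range. -/
noncomputable def X (n m k : ℕ) : V n m :=
  if h : 1 ≤ k ∧ k ≤ n then Finsupp.single (Sum.inl ⟨k - 1, by omega⟩) 1 else 0

/-- `T n m s` is the basis vector `t_s` (`s ∈ {1,2,3}`), or `0` if out of range. -/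
noncomputable def T (n m s : ℕ) : V n m :=
  if h : 1 ≤ s ∧ s ≤ 3 then Finsupp.single (Sum.inr (Sum.inl ⟨s - 1, by omega⟩)) 1 else 0

/-- `Y n m k` is the basis vector `y_k` (1-based), or `0` if out of range. -/
noncomputable def Y (n m k : ℕ) : V n m :=
  if h : 1 ≤ k ∧ k ≤ m then Finsupp.single (Sum.inr (Sum.inr ⟨k - 1, by omega⟩)) 1 else 0

/-- Structure constants of `SL^{n,m}`:
`[x_1,x_i] = x_{i+1}` (2 ≤ i ≤ n-1), `[x_1,y_j] = y_{j+1}` (1 ≤ j ≤ m-1),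
`[t_1,x_i] = i x_i`, `[t_1,y_j] = j y_j`, `[t_2,x_i] = x_i` (2 ≤ i ≤ n),
`[t_3,y_j] = y_j`, extended skew-symmetrically. -/
noncomputable def c (n m : ℕ) : Idx n m → Idx n m → V n m
  | Sum.inl i, Sum.inl j =>
      if i.val = 0 ∧ 1 ≤ j.val then X n m (j.val + 2)
      else if j.val = 0 ∧ 1 ≤ i.val then -X n m (i.val + 2) else 0
  | Sum.inl i, Sum.inr (Sum.inr j) => if i.val = 0 then Y n m (j.val + 2) else 0
  | Sum.inr (Sum.inr j), Sum.inl i => if i.val = 0 then -Y n m (j.val + 2) else 0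
  | Sum.inr (Sum.inl s), Sum.inl i =>
      if s.val = 0 then ((i.val + 1 : ℕ) : ℂ) • X n m (i.val + 1)
      else if s.val = 1 ∧ 1 ≤ i.val then X n m (i.val + 1) else 0
  | Sum.inl i, Sum.inr (Sum.inl s) =>
      -(if s.val = 0 then ((i.val + 1 : ℕ) : ℂ) • X n m (i.val + 1)
        else if s.val = 1 ∧ 1 ≤ i.val then X n m (i.val + 1) else 0)
  | Sum.inr (Sum.inl s), Sum.inr (Sum.inr j) =>
      if s.val = 0 then ((j.val + 1 : ℕ) : ℂ) • Y n m (j.val + 1)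
      else if s.val = 2 then Y n m (j.val + 1) else 0
  | Sum.inr (Sum.inr j), Sum.inr (Sum.inl s) =>
      -(if s.val = 0 then ((j.val + 1 : ℕ) : ℂ) • Y n m (j.val + 1)
        else if s.val = 2 then Y n m (j.val + 1) else 0)
  | Sum.inr (Sum.inl _), Sum.inr (Sum.inl _) => 0
  | Sum.inr (Sum.inr _), Sum.inr (Sum.inr _) => 0

/-- The bracket of `SL^{n,m}`, as a bilinear map. -/
noncomputable def brL (n m : ℕ) : V n m →ₗ[ℂ] V n m →ₗ[ℂ] V n m :=
  Finsupp.lsum ℂ (fun a =>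
    LinearMap.toSpanSingleton ℂ (V n m →ₗ[ℂ] V n m)
      (Finsupp.lsum ℂ (fun b => LinearMap.toSpanSingleton ℂ (V n m) (c n m a b))))

/-- The bracket. -/
noncomputable def br (n m : ℕ) (u v : V n m) : V n m := brL n m u v

/-- Parity of the basis indices (`x`'s and `t`'s even, `y`'s odd). -/
def par (n m : ℕ) : Idx n m → ZMod 2 :=
  Sum.elim (fun _ => 0) (Sum.elim (fun _ => 0) (fun _ => 1))

/-- `u` is homogeneous of degree `s`. -/
def IsHomog (n m : ℕ) (u : V n m) (s : ZMod 2) : Prop :=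
  ∀ a ∈ u.support, par n m a = s

/-- An even superderivation: parity-preserving and `D[u,v] = [Du,v] + [u,Dv]`. -/
def IsEvenDer (n m : ℕ) (D : Module.End ℂ (V n m)) : Prop :=
  (∀ (u : V n m) (s : ZMod 2), IsHomog n m u s → IsHomog n m (D u) s) ∧
  (∀ u v : V n m, D (br n m u v) = br n m (D u) v + br n m u (D v))

/-- An odd superderivation: parity-reversing and
`D[u,v] = [Du,v] + (-1)^{|u|}[u,Dv]` for homogeneous `u`. -/
def IsOddDer (n m : ℕ) (D : Module.End ℂ (V n m)) : Prop :=
  (∀ (u : V n m) (s : ZMod 2), IsHomog n m u s → IsHomog n m (D u) (s + 1)) ∧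
  (∀ (u v : V n m) (su : ZMod 2), IsHomog n m u su →
    D (br n m u v) = br n m (D u) v + ((-1 : ℂ) ^ su.val) • br n m u (D v))


noncomputable def xc (n m k : ℕ) : V n m →ₗ[ℂ] ℂ :=
  if h : 1 ≤ k ∧ k ≤ n then Finsupp.lapply (Sum.inl ⟨k - 1, by omega⟩) else 0

noncomputable def tc (n m k : ℕ) : V n m →ₗ[ℂ] ℂ :=
  if h : 1 ≤ k ∧ k ≤ 3 then Finsupp.lapply (Sum.inr (Sum.inl ⟨k - 1, by omega⟩)) else 0

noncomputable def yc (n m k : ℕ) : V n m →ₗ[ℂ] ℂ :=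
  if h : 1 ≤ k ∧ k ≤ m then Finsupp.lapply (Sum.inr (Sum.inr ⟨k - 1, by omega⟩)) else 0

lemma xc_inl (n m : ℕ) (u : V n m) (i : Fin n) : u (Sum.inl i) = xc n m (i.val + 1) u := by
  have : 1 ≤ i.val + 1 ∧ i.val + 1 ≤ n := by omega
  simp [xc, this]

lemma tc_inl (n m : ℕ) (u : V n m) (i : Fin 3) :
    u (Sum.inr (Sum.inl i)) = tc n m (i.val + 1) u := by
  have : 1 ≤ i.val + 1 ∧ i.val + 1 ≤ 3 := by omega
  simp [tc, this]

lemma yc_inl (n m : ℕ) (u : V n m) (i : Fin m) :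
    u (Sum.inr (Sum.inr i)) = yc n m (i.val + 1) u := by
  have : 1 ≤ i.val + 1 ∧ i.val + 1 ≤ m := by omega
  simp [yc, this]

lemma vext (n m : ℕ) {u v : V n m} (hx : ∀ k, 1 ≤ k → k ≤ n → xc n m k u = xc n m k v)
    (ht : ∀ k, 1 ≤ k → k ≤ 3 → tc n m k u = tc n m k v)
    (hy : ∀ k, 1 ≤ k → k ≤ m → yc n m k u = yc n m k v) : u = v := by
  ext a
  rcases a with i | i | i
  · rw [xc_inl, xc_inl]; exact hx _ (by omega) (by omega)
  · rw [tc_inl, tc_inl]; exact ht _ (by omega) (by omega)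
  · rw [yc_inl, yc_inl]; exact hy _ (by omega) (by omega)

@[simp] lemma xcX (n m j k : ℕ) :
    xc n m j (X n m k) = if j = k ∧ 1 ≤ k ∧ k ≤ n then 1 else 0 := by
  unfold xc X
  split_ifs <;> simp [Finsupp.single_apply] <;> omega
@[simp] lemma xcT (n m j k : ℕ) : xc n m j (T n m k) = 0 := by
  unfold xc T
  split_ifs <;> simp
@[simp] lemma xcY (n m j k : ℕ) : xc n m j (Y n m k) = 0 := by
  unfold xc Y
  split_ifs <;> simp
@[simp] lemma tcT (n m j k : ℕ) :
    tc n m j (T n m k) = if j = k ∧ 1 ≤ k ∧ k ≤ 3 then 1 else 0 := by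
  unfold tc T
  split_ifs <;> simp [Finsupp.single_apply] <;> omega
@[simp] lemma tcX (n m j k : ℕ) : tc n m j (X n m k) = 0 := by
  unfold tc X
  split_ifs <;> simp
@[simp] lemma tcY (n m j k : ℕ) : tc n m j (Y n m k) = 0 := by
  unfold tc Y
  split_ifs <;> simp
@[simp] lemma ycY (n m j k : ℕ) :
    yc n m j (Y n m k) = if j = k ∧ 1 ≤ k ∧ k ≤ m then 1 else 0 := by
  unfold yc Y
  split_ifs <;> simp [Finsupp.single_apply] <;> omega
@[simp] lemma ycX (n m j k : ℕ) : yc n m j (X n m k) = 0 := by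
  unfold yc X
  split_ifs <;> simp
@[simp] lemma ycT (n m j k : ℕ) : yc n m j (T n m k) = 0 := by
  unfold yc T
  split_ifs <;> simp

lemma single_inl (n m : ℕ) (i : Fin n) :
    (Finsupp.single (Sum.inl i) 1 : V n m) = X n m (i.val + 1) := by
  have : 1 ≤ i.val + 1 ∧ i.val + 1 ≤ n := by omega
  simp [X, this]
lemma single_t (n m : ℕ) (i : Fin 3) :
    (Finsupp.single (Sum.inr (Sum.inl i)) 1 : V n m) = T n m (i.val + 1) := by
  have : 1 ≤ i.val + 1 ∧ i.val + 1 ≤ 3 := by omega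
  simp [T, this]
lemma single_y (n m : ℕ) (i : Fin m) :
    (Finsupp.single (Sum.inr (Sum.inr i)) 1 : V n m) = Y n m (i.val + 1) := by
  have : 1 ≤ i.val + 1 ∧ i.val + 1 ≤ m := by omega
  simp [Y, this]

lemma brL_single (n m : ℕ) (a b : Idx n m) :
    brL n m (Finsupp.single a 1) (Finsupp.single b 1) = c n m a b := by
  simp [brL]

/-- induction principle -/
lemma bilin_ext {n m : ℕ} {W : Type*} [AddCommGroup W] [Module ℂ W]
    (F G : V n m →ₗ[ℂ] V n m →ₗ[ℂ] W)
    (h : ∀ a b, F (Finsupp.single a 1) (Finsupp.single b 1)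
      = G (Finsupp.single a 1) (Finsupp.single b 1)) : F = G := by
  ext a b
  simpa using h a b

/-- outer product of functionals -/
noncomputable def op {n m : ℕ} (f g : V n m →ₗ[ℂ] ℂ) : V n m →ₗ[ℂ] V n m →ₗ[ℂ] ℂ :=
  (LinearMap.mul ℂ ℂ).compl₁₂ f g

@[simp] lemma op_apply {n m : ℕ} (f g : V n m →ₗ[ℂ] ℂ) (u v : V n m) :
    op f g u v = f u * g v := rfl

lemma xc_brL (n m k : ℕ) (_hk : 1 ≤ k) (hkn : k ≤ n) (u v : V n m) :
    xc n m k (brL n m u v) =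
      ((k : ℂ) * tc n m 1 u + if 2 ≤ k then tc n m 2 u else 0) * xc n m k v
      - ((k : ℂ) * tc n m 1 v + if 2 ≤ k then tc n m 2 v else 0) * xc n m k u
      + if 3 ≤ k then xc n m 1 u * xc n m (k - 1) v - xc n m (k - 1) u * xc n m 1 v else 0 := by
  obtain ⟨e2, he2⟩ : ∃ e : ℂ, e = if 2 ≤ k then 1 else 0 := ⟨_, rfl⟩
  obtain ⟨e3, he3⟩ : ∃ e : ℂ, e = if 3 ≤ k then 1 else 0 := ⟨_, rfl⟩
  have key : (brL n m).compr₂ (xc n m k) =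
      op ((k : ℂ) • tc n m 1 + e2 • tc n m 2) (xc n m k)
      - op (xc n m k) ((k : ℂ) • tc n m 1 + e2 • tc n m 2)
      + e3 •
        (op (xc n m 1) (xc n m (k-1)) - op (xc n m (k-1)) (xc n m 1)) := by
    apply bilin_ext
    intro a b
    rw [LinearMap.compr₂_apply, brL_single]
    rcases a with i | i | i <;> rcases b with j | j | j <;>
      simp only [single_inl, single_t, single_y, c] <;>
      (try fin_cases i) <;> (try fin_cases j) <;> simp [apply_ite (xc n m k)] <;>
      first | grind | (split_ifs with hh <;> simp [hh])
  have := congrArg (fun F => F u v) key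
  simp only [LinearMap.compr₂_apply, LinearMap.add_apply, LinearMap.sub_apply,
    LinearMap.smul_apply, op_apply] at this
  rw [this, he2, he3]
  split_ifs <;> simp <;> ring

lemma tc_brL (n m k : ℕ) (u v : V n m) : tc n m k (brL n m u v) = 0 := by
  have key : (brL n m).compr₂ (tc n m k) = 0 := by
    apply bilin_ext
    intro a b
    rw [LinearMap.compr₂_apply, brL_single]
    rcases a with i | i | i <;> rcases b with j | j | j <;>
      simp only [c] <;> (try split_ifs) <;> simp
  exact congrArg (fun F => F u v) key

lemma yc_brL (n m k : ℕ) (hk : 1 ≤ k) (hkn : k ≤ m) (u v : V n m) :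
    yc n m k (brL n m u v) =
      ((k : ℂ) * tc n m 1 u + tc n m 3 u) * yc n m k v
      - ((k : ℂ) * tc n m 1 v + tc n m 3 v) * yc n m k u
      + if 2 ≤ k then xc n m 1 u * yc n m (k - 1) v - yc n m (k - 1) u * xc n m 1 v else 0 := by
  obtain ⟨e2, he2⟩ : ∃ e : ℂ, e = if 2 ≤ k then 1 else 0 := ⟨_, rfl⟩
  have key : (brL n m).compr₂ (yc n m k) =
      op ((k : ℂ) • tc n m 1 + tc n m 3) (yc n m k)
      - op (yc n m k) ((k : ℂ) • tc n m 1 + tc n m 3)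
      + e2 •
        (op (xc n m 1) (yc n m (k-1)) - op (yc n m (k-1)) (xc n m 1)) := by
    apply bilin_ext
    intro a b
    rw [LinearMap.compr₂_apply, brL_single]
    rcases a with i | i | i <;> rcases b with j | j | j <;>
      simp only [single_inl, single_t, single_y, c] <;>
      (try fin_cases i) <;> (try fin_cases j) <;> simp [apply_ite (yc n m k)] <;>
      first | grind | (split_ifs with hh <;> simp [hh])
  have := congrArg (fun F => F u v) key
  simp only [LinearMap.compr₂_apply, LinearMap.add_apply, LinearMap.sub_apply,
    LinearMap.smul_apply, op_apply] at this
  rw [this, he2]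
  split_ifs <;> simp <;> ring

lemma jacobi (n m : ℕ) (u v w : V n m) :
    brL n m u (brL n m v w) = brL n m (brL n m u v) w + brL n m v (brL n m u w) := by
  apply vext
  · intro k h1 h2
    by_cases h3 : 3 ≤ k
    · rcases Nat.lt_or_ge 3 k with h4 | h4
      · rw [map_add]
        simp only [xc_brL n m k h1 h2, xc_brL n m (k-1) (by omega) (by omega),
          xc_brL n m 1 (by omega) (by omega), tc_brL]
        have : 2 ≤ k := by omega
        have h5 : 3 ≤ k - 1 := by omega
        have h6 : 2 ≤ k - 1 := by omega
        simp [h3, this, h5, h6, Nat.cast_sub h1]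
        ring
      · obtain rfl : k = 3 := by omega
        rw [map_add]
        simp [xc_brL n m 3 h1 h2, xc_brL n m 2 (by omega) (by omega),
          xc_brL n m 1 (by omega) (by omega), tc_brL]
        ring
    · rw [map_add]
      simp only [xc_brL n m k h1 h2, tc_brL, h3]
      simp only [if_false]
      split_ifs <;> ring
  · intro k _ _
    rw [map_add]; simp [tc_brL]
  · intro k h1 h2
    by_cases h3 : 2 ≤ k
    · by_cases hn : 1 ≤ n
      · rw [map_add]
        simp only [yc_brL n m k h1 h2, yc_brL n m (k-1) (by omega) (by omega),
          xc_brL n m 1 (by omega) hn, tc_brL]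
        rcases Nat.lt_or_ge 2 k with h4 | h4
        · have h6 : 2 ≤ k - 1 := by omega
          simp [h3, h6, Nat.cast_sub h1]
          ring
        · obtain rfl : k = 2 := by omega
          simp
          ring
      · have : xc n m 1 = 0 := by simp [xc]; omega
        rw [map_add]
        simp only [yc_brL n m k h1 h2, this, tc_brL]
        simp
        ring
    · rw [map_add]
      simp only [yc_brL n m k h1 h2, tc_brL, h3]
      simp
      ring

lemma homog0 (n m : ℕ) (u : V n m) : IsHomog n m u 0 ↔ ∀ k, 1 ≤ k → k ≤ m → yc n m k u = 0 := by
  constructor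
  · intro h k h1 h2
    by_contra h3
    have := h (Sum.inr (Sum.inr ⟨k-1, by omega⟩)) (by
      rw [Finsupp.mem_support_iff, yc_inl]
      simpa [Nat.sub_add_cancel h1] using h3)
    simp [par] at this
  · intro h a ha
    rcases a with i | i | i
    · rfl
    · rfl
    · rw [Finsupp.mem_support_iff, yc_inl] at ha
      exact absurd (h _ (by omega) (by omega)) ha

lemma homog1 (n m : ℕ) (u : V n m) : IsHomog n m u 1 ↔
    (∀ k, 1 ≤ k → k ≤ n → xc n m k u = 0) ∧ (∀ k, 1 ≤ k → k ≤ 3 → tc n m k u = 0) := by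
  constructor
  · intro h
    constructor
    · intro k h1 h2
      by_contra h3
      have := h (Sum.inl ⟨k-1, by omega⟩) (by
        rw [Finsupp.mem_support_iff, xc_inl]
        simpa [Nat.sub_add_cancel h1] using h3)
      simp [par] at this
    · intro k h1 h2
      by_contra h3
      have := h (Sum.inr (Sum.inl ⟨k-1, by omega⟩)) (by
        rw [Finsupp.mem_support_iff, tc_inl]
        simpa [Nat.sub_add_cancel h1] using h3)
      simp [par] at this
  · intro h a ha
    rcases a with i | i | i
    · rw [Finsupp.mem_support_iff, xc_inl] at ha
      exact absurd (h.1 _ (by omega) (by omega)) ha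
    · rw [Finsupp.mem_support_iff, tc_inl] at ha
      exact absurd (h.2 _ (by omega) (by omega)) ha
    · rfl

lemma yc_eq_zero (n m k : ℕ) (hk : ¬ (1 ≤ k ∧ k ≤ m)) : yc n m k = 0 := by
  simp only [yc, hk, dite_false]

lemma evenDer_ad (n m : ℕ) (hn : 1 ≤ n) (u : V n m) (hu : IsHomog n m u 0) :
    IsEvenDer n m (brL n m u) := by
  rw [homog0] at hu
  refine ⟨?_, fun v w => jacobi n m u v w⟩
  intro v s hv
  have hs : s = 0 ∨ s = 1 := by clear hv; revert s; decide
  rcases hs with rfl | rfl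
  · rw [homog0] at hv ⊢
    intro k h1 h2
    rw [yc_brL n m k h1 h2, hu k h1 h2, hv k h1 h2]
    split_ifs with h
    · rw [hu (k-1) (by omega) (by omega), hv (k-1) (by omega) (by omega)]; ring
    · ring
  · rw [homog1] at hv ⊢
    refine ⟨?_, fun k _ _ => tc_brL n m k u v⟩
    intro k h1 h2
    rw [xc_brL n m k h1 h2, hv.1 k h1 h2, hv.2 1 (by omega) (by omega),
      hv.2 2 (by omega) (by omega), hv.1 1 (by omega) hn]
    split_ifs
    any_goals rw [hv.1 (k-1) (by omega) (by omega)]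
    all_goals ring

lemma xc_sum (n m j : ℕ) (s : Finset ℕ) (f : ℕ → ℂ) :
    xc n m j (∑ k ∈ s, f k • X n m k) = if j ∈ s ∧ 1 ≤ j ∧ j ≤ n then f j else 0 := by
  rw [map_sum]
  simp only [map_smul, xcX, smul_eq_mul, mul_ite, mul_one, mul_zero, ite_and]
  rw [Finset.sum_ite_eq]

lemma tc_sum (n m j : ℕ) (s : Finset ℕ) (f : ℕ → ℂ) :
    tc n m j (∑ k ∈ s, f k • X n m k) = 0 := by simp
lemma yc_sum (n m j : ℕ) (s : Finset ℕ) (f : ℕ → ℂ) :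
    yc n m j (∑ k ∈ s, f k • X n m k) = 0 := by simp

lemma br_TT (n m i j : ℕ) : brL n m (T n m i) (T n m j) = 0 := by
  apply vext
  · intro k h1 h2
    simp [xc_brL n m k h1 h2]
  · intro k _ _; simp [tc_brL]
  · intro k h1 h2
    simp [yc_brL n m k h1 h2]

lemma br_T1X (n m k : ℕ) : brL n m (T n m 1) (X n m k) = (k : ℂ) • X n m k := by
  apply vext
  · intro j h1 h2
    simp [xc_brL n m j h1 h2]
    grind
  · intro k _ _; simp [tc_brL]
  · intro k h1 h2
    simp [yc_brL n m k h1 h2]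

lemma br_T2X (n m k : ℕ) :
    brL n m (T n m 2) (X n m k) = (if 2 ≤ k then (1 : ℂ) else 0) • X n m k := by
  apply vext
  · intro j h1 h2
    simp [xc_brL n m j h1 h2, apply_ite (xc n m j)]
    grind
  · intro j _ _; simp [tc_brL, apply_ite (tc n m j)]
  · intro j h1 h2
    simp [yc_brL n m j h1 h2, apply_ite (yc n m j)]

lemma br_T3X (n m k : ℕ) : brL n m (T n m 3) (X n m k) = 0 := by
  apply vext
  · intro j h1 h2
    simp [xc_brL n m j h1 h2]
  · intro k _ _; simp [tc_brL]
  · intro k h1 h2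
    simp [yc_brL n m k h1 h2]

lemma br_T1Y (n m k : ℕ) : brL n m (T n m 1) (Y n m k) = (k : ℂ) • Y n m k := by
  apply vext
  · intro j h1 h2
    simp [xc_brL n m j h1 h2]
  · intro k _ _; simp [tc_brL]
  · intro j h1 h2
    simp [yc_brL n m j h1 h2]
    grind

lemma br_T2Y (n m k : ℕ) : brL n m (T n m 2) (Y n m k) = 0 := by
  apply vext
  · intro j h1 h2
    simp [xc_brL n m j h1 h2]
  · intro k _ _; simp [tc_brL]
  · intro j h1 h2
    simp [yc_brL n m j h1 h2]

lemma br_T3Y (n m k : ℕ) : brL n m (T n m 3) (Y n m k) = Y n m k := by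
  apply vext
  · intro j h1 h2
    simp [xc_brL n m j h1 h2]
  · intro k _ _; simp [tc_brL]
  · intro j h1 h2
    simp [yc_brL n m j h1 h2]

lemma br_XX (n m k : ℕ) (h : 2 ≤ k) (hk : k + 1 ≤ n) :
    brL n m (X n m 1) (X n m k) = X n m (k + 1) := by
  apply vext
  · intro j h1 h2
    simp [xc_brL n m j h1 h2]
    grind
  · intro k _ _; simp [tc_brL]
  · intro j h1 h2
    simp [yc_brL n m j h1 h2]

lemma br_XY (n m k : ℕ) (hn : 1 ≤ n) (h : 1 ≤ k) (hk : k + 1 ≤ m) :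
    brL n m (X n m 1) (Y n m k) = Y n m (k + 1) := by
  apply vext
  · intro j h1 h2
    simp [xc_brL n m j h1 h2]
  · intro k _ _; simp [tc_brL]
  · intro j h1 h2
    simp [yc_brL n m j h1 h2]
    grind

lemma evenX (n m k : ℕ) : IsHomog n m (X n m k) 0 := by rw [homog0]; simp
lemma evenT (n m k : ℕ) : IsHomog n m (T n m k) 0 := by rw [homog0]; simp
lemma oddY (n m k : ℕ) : IsHomog n m (Y n m k) 1 := by rw [homog1]; simp

lemma der_zero (n m : ℕ) (hn : 3 ≤ n) (hm : 2 ≤ m) (D : Module.End ℂ (V n m))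
    (hD : IsEvenDer n m D)
    (ha : ∀ k, 2 ≤ k → k ≤ n → xc n m k (D (T n m 2)) = 0)
    (hb : xc n m 1 (D (T n m 1)) = 0) (hc1 : xc n m 1 (D (X n m 1)) = 0)
    (hc2 : xc n m 2 (D (X n m 2)) = 0) (hy1 : yc n m 1 (D (Y n m 1)) = 0) : D = 0 := by
  obtain ⟨hev, hder⟩ := hD
  replace hder : ∀ u v, D (brL n m u v) = brL n m (D u) v + brL n m u (D v) := hder
  have exX : ∀ k, ∀ j, 1 ≤ j → j ≤ m → yc n m j (D (X n m k)) = 0 :=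
    fun k => (homog0 n m _).1 (hev _ _ (evenX n m k))
  have exT : ∀ k, ∀ j, 1 ≤ j → j ≤ m → yc n m j (D (T n m k)) = 0 :=
    fun k => (homog0 n m _).1 (hev _ _ (evenT n m k))
  have exY := fun k => (homog1 n m _).1 (hev _ _ (oddY n m k))
  -- t-components of `D t_i`
  have t1 : ∀ i, 1 ≤ i → i ≤ 3 → tc n m 1 (D (T n m i)) = 0 := by
    intro i h1 h3
    have e := congrArg (xc n m 1) (hder (T n m i) (X n m 1))
    interval_cases i
    · rw [br_T1X] at e
      simpa [xc_brL n m 1 (by omega) (show 1 ≤ n by omega), hc1, show 1 ≤ n by omega] using e.symm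
    · rw [br_T2X] at e
      simpa [xc_brL n m 1 (by omega) (show 1 ≤ n by omega), hc1, show 1 ≤ n by omega] using e.symm
    · rw [br_T3X] at e
      simpa [xc_brL n m 1 (by omega) (show 1 ≤ n by omega), hc1, show 1 ≤ n by omega] using e.symm
  have t2 : ∀ i, 1 ≤ i → i ≤ 3 → tc n m 2 (D (T n m i)) = 0 := by
    intro i h1 h3
    have e := congrArg (xc n m 2) (hder (T n m i) (X n m 2))
    have e1 := t1 i h1 h3
    interval_cases i
    · rw [br_T1X] at e
      simpa [xc_brL n m 2 (by omega) (show 2 ≤ n by omega), hc2, e1, show 2 ≤ n by omega] using e.symm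
    · rw [br_T2X] at e
      simpa [xc_brL n m 2 (by omega) (show 2 ≤ n by omega), hc2, e1, show 2 ≤ n by omega] using e.symm
    · rw [br_T3X] at e
      simpa [xc_brL n m 2 (by omega) (show 2 ≤ n by omega), hc2, e1, show 2 ≤ n by omega] using e.symm
  have t3 : ∀ i, 1 ≤ i → i ≤ 3 → tc n m 3 (D (T n m i)) = 0 := by
    intro i h1 h3
    have e := congrArg (yc n m 1) (hder (T n m i) (Y n m 1))
    have e1 := t1 i h1 h3
    interval_cases i
    · rw [br_T1Y] at e
      simpa [yc_brL n m 1 (by omega) (show 1 ≤ m by omega), hy1, e1, show 1 ≤ m by omega] using e.symm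
    · rw [br_T2Y] at e
      simpa [yc_brL n m 1 (by omega) (show 1 ≤ m by omega), hy1, e1, show 1 ≤ m by omega] using e.symm
    · rw [br_T3Y] at e
      simpa [yc_brL n m 1 (by omega) (show 1 ≤ m by omega), hy1, e1, show 1 ≤ m by omega] using e.symm
  -- x-components of `D t_i`
  have x3 : ∀ i, 1 ≤ i → i ≤ 3 → ∀ k, 1 ≤ k → k ≤ n → xc n m k (D (T n m i)) = 0 := by
    intro i h1 h3 k hk1 hk2
    have hk0 : (k : ℂ) ≠ 0 := by exact_mod_cast (by omega : k ≠ 0)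
    interval_cases i
    · rcases Nat.lt_or_ge k 2 with h | h
      · obtain rfl : k = 1 := by omega
        exact hb
      · have e := congrArg (xc n m k) (hder (T n m 2) (T n m 1))
        rw [br_TT, map_add] at e
        simpa [xc_brL n m k hk1 hk2, ha k h hk2, h] using e.symm
    · rcases Nat.lt_or_ge k 2 with h | h
      · obtain rfl : k = 1 := by omega
        have e := congrArg (xc n m 1) (hder (T n m 2) (T n m 1))
        rw [br_TT, map_add] at e
        simpa [xc_brL n m 1 hk1 hk2] using e
      · exact ha k h hk2
    · have e := congrArg (xc n m k) (hder (T n m 3) (T n m 1))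
      rw [br_TT, map_add] at e
      simpa [xc_brL n m k hk1 hk2, hk0, show k ≠ 0 by omega] using e
  have DT : ∀ i, 1 ≤ i → i ≤ 3 → D (T n m i) = 0 := by
    intro i h1 h3
    apply vext
    · intro k hk1 hk2
      rw [x3 i h1 h3 k hk1 hk2, map_zero]
    · intro k hk1 hk2
      rw [map_zero]
      interval_cases k
      · exact t1 i h1 h3
      · exact t2 i h1 h3
      · exact t3 i h1 h3
    · intro k hk1 hk2
      rw [exT i k hk1 hk2, map_zero]
  have D1 := DT 1 (by omega) (by omega)
  have hX : ∀ k, 1 ≤ k → k ≤ n → xc n m k (D (X n m k)) = 0 → D (X n m k) = 0 := by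
    intro k h1 h2 h0
    have e := hder (T n m 1) (X n m k)
    rw [D1, br_T1X] at e
    apply vext
    · intro j hj1 hj2
      rw [map_zero]
      by_cases hjk : j = k
      · rw [hjk, h0]
      · have e' := congrArg (xc n m j) e
        simp [xc_brL n m j hj1 hj2] at e'
        rcases e' with e' | e'
        · exact absurd e'.symm hjk
        · exact e'
    · intro j hj1 hj2
      have e' := congrArg (tc n m j) e
      simp [tc_brL] at e'
      rw [map_zero]
      rcases e' with e' | e'
      · omega
      · exact e'
    · intro j hj1 hj2
      rw [exX k j hj1 hj2, map_zero]
  have hY : ∀ k, 1 ≤ k → k ≤ m → yc n m k (D (Y n m k)) = 0 → D (Y n m k) = 0 := by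
    intro k h1 h2 h0
    have e := hder (T n m 1) (Y n m k)
    rw [D1, br_T1Y] at e
    apply vext
    · intro j hj1 hj2
      rw [map_zero]; exact (exY k).1 j hj1 hj2
    · intro j hj1 hj2
      rw [map_zero]; exact (exY k).2 j hj1 hj2
    · intro j hj1 hj2
      rw [map_zero]
      by_cases hjk : j = k
      · rw [hjk, h0]
      · have e' := congrArg (yc n m j) e
        simp [yc_brL n m j hj1 hj2] at e'
        rcases e' with e' | e'
        · exact absurd e'.symm hjk
        · exact e'
  have DX1 := hX 1 (by omega) (by omega) hc1
  have DX : ∀ k, 2 ≤ k → k ≤ n → D (X n m k) = 0 := by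
    intro k hk
    induction k, hk using Nat.le_induction with
    | base => intro _; exact hX 2 (by omega) (by omega) hc2
    | succ k hk ih =>
      intro h
      rw [← br_XX n m k hk h, hder, DX1, ih (by omega)]
      simp
  have DY : ∀ k, 1 ≤ k → k ≤ m → D (Y n m k) = 0 := by
    intro k hk
    induction k, hk using Nat.le_induction with
    | base => intro _; exact hY 1 (by omega) (by omega) hy1
    | succ k hk ih =>
      intro h
      rw [← br_XY n m k (by omega) hk h, hder, DX1, ih (by omega)]
      simp
  apply Finsupp.lhom_ext'
  intro a
  apply LinearMap.ext_ring
  rw [LinearMap.comp_apply, Finsupp.lsingle_apply, LinearMap.zero_comp, LinearMap.zero_apply]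
  rcases a with i | i | i
  · rw [single_inl]
    rcases Nat.eq_zero_or_pos i.val with h | h
    · rw [h]; exact DX1
    · exact DX _ (by omega) (by omega)
  · rw [single_t]; exact DT _ (by omega) (by omega)
  · rw [single_y]; exact DY _ (by omega) (by omega)

lemma evenDer_sub (n m : ℕ) (D E : Module.End ℂ (V n m)) (hD : IsEvenDer n m D)
    (hE : IsEvenDer n m E) : IsEvenDer n m (D - E) := by
  constructor
  · intro u s hu a ha
    have h1 := hD.1 u s hu a
    have h2 := hE.1 u s hu a
    by_contra hs
    rw [Finsupp.mem_support_iff] at *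
    apply ha
    rw [LinearMap.sub_apply, Finsupp.sub_apply, not_ne_iff.1 (fun h => hs (h1 h)),
      not_ne_iff.1 (fun h => hs (h2 h)), sub_zero]
  · intro u v
    have h1 := hD.2 u v
    have h2 := hE.2 u v
    simp only [br, LinearMap.sub_apply, map_sub] at *
    rw [h1, h2]
    abel

lemma der_inner (n m : ℕ) (hn : 3 ≤ n) (hm : 2 ≤ m) (D : Module.End ℂ (V n m))
    (hD : IsEvenDer n m D) : ∃ u : V n m, IsHomog n m u 0 ∧ D = brL n m u := by
  set f : ℕ → ℂ := fun k => if k = 1 then -xc n m 1 (D (T n m 1)) else -xc n m k (D (T n m 2))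
    with hf
  set g1 := xc n m 1 (D (X n m 1)) with hg1
  set g2 := xc n m 2 (D (X n m 2)) - 2 * g1 with hg2
  set g3 := yc n m 1 (D (Y n m 1)) - g1 with hg3
  set u : V n m := ∑ k ∈ Finset.Icc 1 n, f k • X n m k + g1 • T n m 1 + g2 • T n m 2
    + g3 • T n m 3 with hu
  have hux : ∀ k, 1 ≤ k → k ≤ n → xc n m k u = f k := by
    intro k h1 h2
    rw [hu, map_add, map_add, map_add, xc_sum]
    simp [h1, h2]
  have hu1 : tc n m 1 u = g1 := by
    rw [hu, map_add, map_add, map_add, tc_sum]; simp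
  have hu2 : tc n m 2 u = g2 := by
    rw [hu, map_add, map_add, map_add, tc_sum]; simp
  have hu3 : tc n m 3 u = g3 := by
    rw [hu, map_add, map_add, map_add, tc_sum]; simp
  have hu0 : IsHomog n m u 0 := by
    rw [homog0]; intro k _ _
    rw [hu, map_add, map_add, map_add, yc_sum]; simp
  refine ⟨u, hu0, ?_⟩
  rw [← sub_eq_zero]
  have hn1 : 1 ≤ n := by omega
  have hn2 : 2 ≤ n := by omega
  have hm1 : 1 ≤ m := by omega
  apply der_zero n m hn hm _ (evenDer_sub n m _ _ hD (evenDer_ad n m hn1 u hu0))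
  · intro k h1 h2
    rw [LinearMap.sub_apply, map_sub, xc_brL n m k (by omega) h2, hux k (by omega) h2]
    simp [hf, show k ≠ 1 by omega, h1]
  · rw [LinearMap.sub_apply, map_sub, xc_brL n m 1 (by omega) hn1, hux 1 (by omega) hn1]
    simp [hf]
  · rw [LinearMap.sub_apply, map_sub, xc_brL n m 1 (by omega) hn1, hu1]
    simp [hn1, hg1]
  · rw [LinearMap.sub_apply, map_sub, xc_brL n m 2 (by omega) hn2, hu1, hu2]
    simp [hn2, hg2]
  · rw [LinearMap.sub_apply, map_sub, yc_brL n m 1 (by omega) hm1, hu1, hu3]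
    simp [hm1, hg3]

lemma ad_injective (n m : ℕ) (hn : 3 ≤ n) (hm : 2 ≤ m) : ∀ u, brL n m u = 0 → u = 0 := by
  intro u hu
  have h : ∀ v, brL n m u v = 0 := fun v => by rw [hu, LinearMap.zero_apply]
  have hT := h (T n m 1)
  have e1 := congrArg (xc n m 1) (h (X n m 1))
  have e2 := congrArg (xc n m 2) (h (X n m 2))
  have e3 := congrArg (yc n m 1) (h (Y n m 1))
  have hn1 : 1 ≤ n := by omega
  have hn2 : 2 ≤ n := by omega
  have hm1 : 1 ≤ m := by omega
  simp [xc_brL n m 1 (by omega) hn1, hn1] at e1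
  simp [xc_brL n m 2 (by omega) hn2, hn2, e1] at e2
  simp [yc_brL n m 1 (by omega) hm1, hm1, e1] at e3
  apply vext
  · intro k h1 h2
    have e := congrArg (xc n m k) hT
    simp [xc_brL n m k h1 h2, show k ≠ 0 by omega] at e
    simpa using e
  · intro k h1 h2
    rw [map_zero]
    interval_cases k <;> assumption
  · intro k h1 h2
    have e := congrArg (yc n m k) hT
    simp [yc_brL n m k h1 h2, show k ≠ 0 by omega] at e
    simpa using e

/-- the even basis indices -/
def ev (n m : ℕ) (i : Fin (n + 3)) : Idx n m :=
  Sum.elim Sum.inl (fun j => Sum.inr (Sum.inl j)) (finSumFinEquiv.symm i)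

lemma ev_inj (n m : ℕ) : Function.Injective (ev n m) := by
  have : Function.Injective
      (Sum.elim Sum.inl (fun j => Sum.inr (Sum.inl j)) : Fin n ⊕ Fin 3 → Idx n m) := by
    rintro (a | a) (b | b) h <;> simp_all
  exact this.comp finSumFinEquiv.symm.injective

set_option maxHeartbeats 1000000 in
/-- Classification of even superderivations of `SL^{n,m}`: every even superderivation is
determined by the `n+3` parameters `a_1, a_3, …, a_n, b_2, b_3, d_n, p_1`, and
`dim Der₀(SL^{n,m}) = n + 3`. -/
theorem evenSuperderivations_SL (n m : ℕ) (hn : 3 ≤ n) (hm : 2 ≤ m) :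
    (∀ D : Module.End ℂ (V n m), IsEvenDer n m D →
      ∃ (a : ℕ → ℂ) (b2 b3 dn p1 : ℂ),
        D (T n m 1) = -(b3 • X n m 1) +
            (∑ k ∈ Finset.Icc 2 (n - 1), ((k : ℂ) * a (k + 1)) • X n m k) +
            ((n : ℂ) * dn) • X n m n ∧
        D (T n m 2) = (∑ k ∈ Finset.Icc 2 (n - 1), a (k + 1) • X n m k) + dn • X n m n ∧
        D (T n m 3) = 0 ∧
        D (X n m 1) = a 1 • X n m 1 + ∑ k ∈ Finset.Icc 3 n, a k • X n m k ∧
        D (X n m 2) = b2 • X n m 2 + b3 • X n m 3 ∧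
        (∀ i : ℕ, 3 ≤ i → i ≤ n →
          D (X n m i) = (((i : ℂ) - 2) * a 1 + b2) • X n m i + b3 • X n m (i + 1)) ∧
        D (Y n m 1) = p1 • Y n m 1 + b3 • Y n m 2 ∧
        (∀ j : ℕ, 2 ≤ j → j ≤ m →
          D (Y n m j) = (((j : ℂ) - 1) * a 1 + p1) • Y n m j + b3 • Y n m (j + 1))) ∧
    (∃ B : Fin (n + 3) → Module.End ℂ (V n m),
      LinearIndependent ℂ B ∧ (∀ i, IsEvenDer n m (B i)) ∧
      ∀ D : Module.End ℂ (V n m), IsEvenDer n m D → D ∈ Submodule.span ℂ (Set.range B)) := by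
  constructor
  · intro D hD
    obtain ⟨u, hu0, rfl⟩ := der_inner n m hn hm D hD
    rw [homog0] at hu0
    have hn1 : 1 ≤ n := by omega
    have hyz : ∀ k, yc n m k u = 0 := by
      intro k
      by_cases hk : 1 ≤ k ∧ k ≤ m
      · exact hu0 k hk.1 hk.2
      · rw [yc_eq_zero n m k hk, LinearMap.zero_apply]
    refine ⟨fun k => if k = 1 then tc n m 1 u else -xc n m (k - 1) u,
      2 * tc n m 1 u + tc n m 2 u, xc n m 1 u, -xc n m n u, tc n m 1 u + tc n m 3 u,
      ?_, ?_, ?_, ?_, ?_, ?_, ?_, ?_⟩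
    · apply vext
      · intro k h1 h2
        rw [map_add, map_add, xc_sum, xc_brL n m k h1 h2]
        simp
        rcases eq_or_ne k 1 with rfl | hk1
        · simp <;> grind
        rcases eq_or_ne k 2 with rfl | hk2
        · simp <;> grind
        grind
      · intro k _ _
        rw [map_add, map_add, tc_sum, tc_brL]; simp
      · intro k h1 h2
        rw [map_add, map_add, yc_sum, yc_brL n m k h1 h2]; simp [hyz]
    · apply vext
      · intro k h1 h2
        rw [map_add, xc_sum, xc_brL n m k h1 h2]
        simp
        rcases eq_or_ne k 1 with rfl | hk1
        · simp <;> grind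
        rcases eq_or_ne k 2 with rfl | hk2
        · simp <;> grind
        grind
      · intro k _ _
        rw [map_add, tc_sum, tc_brL]; simp
      · intro k h1 h2
        rw [map_add, yc_sum, yc_brL n m k h1 h2]; simp [hyz]
    · apply vext
      · intro k h1 h2
        rw [xc_brL n m k h1 h2]
        simp
      · intro k _ _
        rw [tc_brL]; simp
      · intro k h1 h2
        rw [yc_brL n m k h1 h2]; simp [hyz]
    · apply vext
      · intro k h1 h2
        rw [map_add, xc_sum, xc_brL n m k h1 h2]
        simp
        rcases eq_or_ne k 1 with rfl | hk1
        · simp <;> grind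
        rcases eq_or_ne k 2 with rfl | hk2
        · simp <;> grind
        grind
      · intro k _ _
        rw [map_add, tc_sum, tc_brL]; simp
      · intro k h1 h2
        rw [map_add, yc_sum, yc_brL n m k h1 h2]; simp [hyz]
    · apply vext
      · intro k h1 h2
        rw [map_add, xc_brL n m k h1 h2]
        simp
        rcases eq_or_ne k 1 with rfl | hk1
        · simp <;> grind
        rcases eq_or_ne k 2 with rfl | hk2
        · simp <;> grind
        grind
      · intro k _ _
        rw [map_add, tc_brL]; simp
      · intro k h1 h2
        rw [map_add, yc_brL n m k h1 h2]; simp [hyz]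
    · intro i hi1 hi2
      apply vext
      · intro k h1 h2
        rw [map_add, xc_brL n m k h1 h2]
        simp
        grind
      · intro k _ _
        rw [map_add, tc_brL]; simp
      · intro k h1 h2
        rw [map_add, yc_brL n m k h1 h2]; simp [hyz]
    · apply vext
      · intro k h1 h2
        rw [map_add, xc_brL n m k h1 h2]
        simp
      · intro k _ _
        rw [map_add, tc_brL]; simp
      · intro k h1 h2
        rw [map_add, yc_brL n m k h1 h2]; simp [hyz]
        rcases eq_or_ne k 1 with rfl | hk1
        · simp <;> grind
        rcases eq_or_ne k 2 with rfl | hk2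
        · simp <;> grind
        grind
    · intro j hj1 hj2
      apply vext
      · intro k h1 h2
        rw [map_add, xc_brL n m k h1 h2]
        simp
      · intro k _ _
        rw [map_add, tc_brL]; simp
      · intro k h1 h2
        rw [map_add, yc_brL n m k h1 h2]; simp [hyz]
        grind
  · refine ⟨fun i => brL n m (Finsupp.single (ev n m i) 1), ?_, ?_, ?_⟩
    · have h1 : LinearIndependent ℂ (fun a : Idx n m => (Finsupp.single a 1 : V n m)) := by
        simpa using (Finsupp.basisSingleOne (R := ℂ) (ι := Idx n m)).linearIndependent
      have h2 := h1.comp (ev n m) (ev_inj n m)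
      have hinj : Function.Injective (brL n m) := by
        intro u v huv
        have huv' : brL n m (u - v) = 0 := by
          rw [map_sub, huv]
          exact sub_self _
        exact sub_eq_zero.1 (ad_injective n m hn hm _ huv')
      unfold LinearIndependent at h2 ⊢
      have h3 : ∀ g, Finsupp.linearCombination ℂ
          (fun i => brL n m (Finsupp.single (ev n m i) 1)) g =
          brL n m (Finsupp.linearCombination ℂ
            ((fun a : Idx n m => (Finsupp.single a 1 : V n m)) ∘ ev n m) g) := by
        intro g
        rw [Finsupp.apply_linearCombination]
        rfl
      intro g g' hg
      exact h2 (hinj ((h3 g).symm.trans (hg.trans (h3 g'))))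
    · intro i
      apply evenDer_ad n m (by omega)
      unfold ev
      rcases finSumFinEquiv.symm i with j | j
      · simp only [Sum.elim_inl, single_inl]; exact evenX n m _
      · simp only [Sum.elim_inr, single_t]; exact evenT n m _
    · intro D hD
      obtain ⟨u, hu0, rfl⟩ := der_inner n m hn hm D hD
      have h2 : brL n m u = ∑ a ∈ u.support, u a • brL n m (Finsupp.single a 1) := by
        conv_lhs => rw [← Finsupp.sum_single u, Finsupp.sum, map_sum]
        refine Finset.sum_congr rfl fun a _ => ?_
        rw [← map_smul, Finsupp.smul_single, smul_eq_mul, mul_one]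
      rw [h2]
      refine Submodule.sum_mem _ fun a ha => Submodule.smul_mem _ _ (Submodule.subset_span ?_)
      have hp := hu0 a ha
      rcases a with i | i | i
      · exact ⟨finSumFinEquiv (Sum.inl i), by simp [ev]⟩
      · exact ⟨finSumFinEquiv (Sum.inr i), by simp [ev]⟩
      · simp [par] at hp

end SolvableModelFiliform
end

section
/- Every superderivation of SLP^{n,m} is even, and there exist scalars α, β, γ, δ such that d(x_1)=α x_1, d(x_i)=(β+(i-2)α)x_i - γ x_{i+1} (2≤i≤n, with x_{n+1}=0), d(t_1)=γ x_1, d(t_2)=d(t_3)=0, d(y_1)=δ y_1 - γ y_2, d(y_j)=(δ+(j-1)α)y_j - γ y_{j+1} (2≤j≤m, with y_{m+1}=0); hence d = -γ R_{x_1} + α R_{t_1} + β R_{t_2} + δ R_{t_3}, dim Der(SLP^{n,m}) = 4, and every superderivation is inner (a right multiplication operator). -/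
namespace SolvableFiliformLeibniz

/-- Index type of `SLP^{n,m}`: `x`-indices, then `t`-indices, then `y`-indices. -/
abbrev Idx (n m : ℕ) := Fin n ⊕ (Fin 3 ⊕ Fin m)

/-- Underlying vector space over ℂ. -/
abbrev V (n m : ℕ) := Idx n m →₀ ℂ

/-- `X n m k` is the basis vector `x_k` (1-based), or `0` if out of range. -/
noncomputable def X (n m k : ℕ) : V n m :=
  if h : 1 ≤ k ∧ k ≤ n then Finsupp.single (Sum.inl ⟨k - 1, by omega⟩) 1 else 0

/-- `T n m s` is the basis vector `t_s` (`s ∈ {1,2,3}`), or `0` if out of range. -/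
noncomputable def T (n m s : ℕ) : V n m :=
  if h : 1 ≤ s ∧ s ≤ 3 then Finsupp.single (Sum.inr (Sum.inl ⟨s - 1, by omega⟩)) 1 else 0

/-- `Y n m k` is the basis vector `y_k` (1-based), or `0` if out of range. -/
noncomputable def Y (n m k : ℕ) : V n m :=
  if h : 1 ≤ k ∧ k ≤ m then Finsupp.single (Sum.inr (Sum.inr ⟨k - 1, by omega⟩)) 1 else 0

/-- Structure constants of `SLP^{n,m}`:
`[x_i,x_1]=x_{i+1}` (2 ≤ i ≤ n-1), `[y_j,x_1]=y_{j+1}` (1 ≤ j ≤ m-1), `[t_1,x_1]=-x_1`,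
`[x_1,t_1]=x_1`, `[x_i,t_1]=(i-2)x_i` (3 ≤ i ≤ n), `[y_j,t_1]=(j-1)y_j` (2 ≤ j ≤ m),
`[x_i,t_2]=x_i` (2 ≤ i ≤ n), `[y_j,t_3]=y_j` (1 ≤ j ≤ m); all other products zero. -/
noncomputable def c (n m : ℕ) : Idx n m → Idx n m → V n m
  | Sum.inl i, Sum.inl j => if j.val = 0 ∧ 1 ≤ i.val then X n m (i.val + 2) else 0
  | Sum.inr (Sum.inr j), Sum.inl i => if i.val = 0 then Y n m (j.val + 2) else 0
  | Sum.inr (Sum.inl s), Sum.inl i =>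
      if s.val = 0 ∧ i.val = 0 then -X n m 1 else 0
  | Sum.inl i, Sum.inr (Sum.inl s) =>
      if s.val = 0 then
        (if i.val = 0 then X n m 1 else ((i.val - 1 : ℕ) : ℂ) • X n m (i.val + 1))
      else if s.val = 1 ∧ 1 ≤ i.val then X n m (i.val + 1) else 0
  | Sum.inr (Sum.inr j), Sum.inr (Sum.inl s) =>
      if s.val = 0 then ((j.val : ℕ) : ℂ) • Y n m (j.val + 1)
      else if s.val = 2 then Y n m (j.val + 1) else 0
  | _, _ => 0

/-- The product of `SLP^{n,m}`, as a bilinear map. -/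
noncomputable def br (n m : ℕ) (u v : V n m) : V n m :=
  Finsupp.lsum ℂ (fun a =>
    LinearMap.toSpanSingleton ℂ (V n m →ₗ[ℂ] V n m)
      (Finsupp.lsum ℂ (fun b => LinearMap.toSpanSingleton ℂ (V n m) (c n m a b)))) u v

/-- Parity of the basis indices (`x`'s and `t`'s even, `y`'s odd). -/
def par (n m : ℕ) : Idx n m → ZMod 2 :=
  Sum.elim (fun _ => 0) (Sum.elim (fun _ => 0) (fun _ => 1))

/-- `u` is homogeneous of degree `s`. -/
def IsHomog (n m : ℕ) (u : V n m) (s : ZMod 2) : Prop :=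
  ∀ a ∈ u.support, par n m a = s

/-- An even superderivation of `SLP^{n,m}`: parity-preserving with
`d[x,y] = [dx,y] + [x,dy]`. -/
def IsEvenDer (n m : ℕ) (D : Module.End ℂ (V n m)) : Prop :=
  (∀ (u : V n m) (s : ZMod 2), IsHomog n m u s → IsHomog n m (D u) s) ∧
  (∀ u v : V n m, D (br n m u v) = br n m (D u) v + br n m u (D v))

/-- An odd superderivation of `SLP^{n,m}`: parity-reversing with
`d[x,y] = (-1)^{|y|}[dx,y] + [x,dy]` for homogeneous `y`. -/
def IsOddDer (n m : ℕ) (D : Module.End ℂ (V n m)) : Prop :=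
  (∀ (u : V n m) (s : ZMod 2), IsHomog n m u s → IsHomog n m (D u) (s + 1)) ∧
  (∀ (u v : V n m) (sv : ZMod 2), IsHomog n m v sv →
    D (br n m u v) = ((-1 : ℂ) ^ sv.val) • br n m (D u) v + br n m u (D v))

theorem br_add_left (n m : ℕ) (u u' v : V n m) : br n m (u + u') v = br n m u v + br n m u' v := by
  simp only [br, map_add, LinearMap.add_apply]

theorem br_smul_left (n m : ℕ) (r : ℂ) (u v : V n m) : br n m (r • u) v = r • br n m u v := by
  simp only [br, map_smul, LinearMap.smul_apply]

theorem br_add_right (n m : ℕ) (u v v' : V n m) : br n m u (v + v') = br n m u v + br n m u v' := by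
  simp only [br, map_add]

theorem br_smul_right (n m : ℕ) (r : ℂ) (u v : V n m) : br n m u (r • v) = r • br n m u v := by
  simp only [br, map_smul]

theorem br_zero_left (n m : ℕ) (v : V n m) : br n m 0 v = 0 := by
  simp [br]

theorem br_zero_right (n m : ℕ) (v : V n m) : br n m v 0 = 0 := by
  simp [br]

/-- Right multiplication as a linear map. -/
noncomputable def Rm (n m : ℕ) (v : V n m) : Module.End ℂ (V n m) where
  toFun u := br n m u v
  map_add' u u' := br_add_left n m u u' v
  map_smul' r u := br_smul_left n m r u v

theorem br_single (n m : ℕ) (a b : Idx n m) (r s : ℂ) :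
    br n m (Finsupp.single a r) (Finsupp.single b s) = (r * s) • c n m a b := by
  simp [br, LinearMap.toSpanSingleton, smul_smul]

theorem X_succ (n m k : ℕ) (h : k < n) :
    X n m (k + 1) = Finsupp.single (Sum.inl ⟨k, h⟩) 1 := by
  have : 1 ≤ k + 1 ∧ k + 1 ≤ n := by omega
  simp [X, this]

theorem X_big (n m k : ℕ) (h : n < k) : X n m k = 0 := by
  have : ¬ (1 ≤ k ∧ k ≤ n) := by omega
  simp only [X, this, dite_false]

theorem Y_succ (n m k : ℕ) (h : k < m) :
    Y n m (k + 1) = Finsupp.single (Sum.inr (Sum.inr ⟨k, h⟩)) 1 := by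
  have : 1 ≤ k + 1 ∧ k + 1 ≤ m := by omega
  simp [Y, this]

theorem Y_big (n m k : ℕ) (h : m < k) : Y n m k = 0 := by
  have : ¬ (1 ≤ k ∧ k ≤ m) := by omega
  simp only [Y, this, dite_false]

theorem T_one (n m : ℕ) : T n m 1 = Finsupp.single (Sum.inr (Sum.inl 0)) 1 := by
  simp [T]
theorem T_two (n m : ℕ) : T n m 2 = Finsupp.single (Sum.inr (Sum.inl 1)) 1 := by
  simp [T]
theorem T_three (n m : ℕ) : T n m 3 = Finsupp.single (Sum.inr (Sum.inl 2)) 1 := by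
  simp [T]

theorem X_apply_x (n m k : ℕ) (i : Fin n) :
    X n m k (Sum.inl i) = if k = i.val + 1 then 1 else 0 := by
  unfold X
  split_ifs with h h1 h1
  · subst h1; simp
  · rw [Finsupp.single_apply, if_neg]
    intro h2
    have := congrArg Fin.val (Sum.inl.inj h2)
    simp at this
    omega
  · exfalso; have := i.2; omega
  · rfl

theorem X_apply_r (n m k : ℕ) (a : Fin 3 ⊕ Fin m) : X n m k (Sum.inr a) = 0 := by
  unfold X
  split_ifs with h <;> simp

theorem Y_apply_y (n m k : ℕ) (i : Fin m) :
    Y n m k (Sum.inr (Sum.inr i)) = if k = i.val + 1 then 1 else 0 := by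
  unfold Y
  split_ifs with h h1 h1
  · subst h1; simp
  · rw [Finsupp.single_apply, if_neg]
    intro h2
    have := congrArg Fin.val (Sum.inr.inj (Sum.inr.inj h2))
    simp at this
    omega
  · exfalso; have := i.2; omega
  · rfl

theorem Y_apply_x (n m k : ℕ) (a : Fin n) : Y n m k (Sum.inl a) = 0 := by
  unfold Y
  split_ifs with h <;> simp

theorem Y_apply_t (n m k : ℕ) (a : Fin 3) : Y n m k (Sum.inr (Sum.inl a)) = 0 := by
  unfold Y
  split_ifs with h <;> simp

theorem lin_ext {n m : ℕ} (f g : V n m →ₗ[ℂ] V n m)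
    (hx : ∀ i : Fin n, f (X n m (i.val + 1)) = g (X n m (i.val + 1)))
    (h1 : f (T n m 1) = g (T n m 1)) (h2 : f (T n m 2) = g (T n m 2))
    (h3 : f (T n m 3) = g (T n m 3))
    (hy : ∀ j : Fin m, f (Y n m (j.val + 1)) = g (Y n m (j.val + 1))) : f = g := by
  apply Finsupp.lhom_ext'
  intro a
  apply LinearMap.ext_ring
  rcases a with i | s | j
  · have := hx i
    rw [X_succ n m i.val i.2] at this
    exact this
  · rw [T_one] at h1
    rw [T_two] at h2
    rw [T_three] at h3
    fin_cases s
    · exact h1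
    · exact h2
    · exact h3
  · have := hy j
    rw [Y_succ n m j.val j.2] at this
    exact this

/-- first coordinate helper: explicit right multiplication by `x_1`, `t_1`, `t_2`, `t_3`. -/
noncomputable def xc {n m : ℕ} (u : V n m) (i : ℕ) : ℂ :=
  if h : i < n then u (Sum.inl ⟨i, h⟩) else 0
noncomputable def yc {n m : ℕ} (u : V n m) (i : ℕ) : ℂ :=
  if h : i < m then u (Sum.inr (Sum.inr ⟨i, h⟩)) else 0
noncomputable def tc {n m : ℕ} (u : V n m) (i : Fin 3) : ℂ := u (Sum.inr (Sum.inl i))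

theorem xc_add {n m : ℕ} (u v : V n m) (i : ℕ) : xc (u + v) i = xc u i + xc v i := by
  unfold xc; split_ifs <;> simp
theorem yc_add {n m : ℕ} (u v : V n m) (i : ℕ) : yc (u + v) i = yc u i + yc v i := by
  unfold yc; split_ifs <;> simp
theorem tc_add {n m : ℕ} (u v : V n m) (i : Fin 3) : tc (u + v) i = tc u i + tc v i := rfl
theorem xc_smul {n m : ℕ} (r : ℂ) (v : V n m) (i : ℕ) : xc (r • v) i = r * xc v i := by
  unfold xc; split_ifs <;> simp
theorem yc_smul {n m : ℕ} (r : ℂ) (v : V n m) (i : ℕ) : yc (r • v) i = r * yc v i := by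
  unfold yc; split_ifs <;> simp
theorem tc_smul {n m : ℕ} (r : ℂ) (v : V n m) (i : Fin 3) : tc (r • v) i = r * tc v i := rfl
theorem xc_zero {n m : ℕ} (i : ℕ) : xc (0 : V n m) i = 0 := by
  unfold xc; split_ifs <;> simp
theorem yc_zero {n m : ℕ} (i : ℕ) : yc (0 : V n m) i = 0 := by
  unfold yc; split_ifs <;> simp
theorem tc_zero {n m : ℕ} (i : Fin 3) : tc (0 : V n m) i = 0 := rfl
theorem xc_neg {n m : ℕ} (v : V n m) (i : ℕ) : xc (-v) i = - xc v i := by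
  unfold xc; split_ifs <;> simp
theorem yc_neg {n m : ℕ} (v : V n m) (i : ℕ) : yc (-v) i = - yc v i := by
  unfold yc; split_ifs <;> simp
theorem tc_neg {n m : ℕ} (v : V n m) (i : Fin 3) : tc (-v) i = - tc v i := rfl

theorem xc_X (n m k i : ℕ) : xc (X n m k) i = if k = i + 1 ∧ i < n then 1 else 0 := by
  unfold xc; split_ifs <;> simp_all [X_apply_x]
theorem xc_Y (n m k i : ℕ) : xc (Y n m k) i = 0 := by
  unfold xc; split_ifs <;> simp_all [Y_apply_x]
theorem yc_X (n m k i : ℕ) : yc (X n m k) i = 0 := by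
  unfold yc; split_ifs <;> simp_all [X_apply_r]
theorem yc_Y (n m k i : ℕ) : yc (Y n m k) i = if k = i + 1 ∧ i < m then 1 else 0 := by
  unfold yc; split_ifs <;> simp_all [Y_apply_y]
theorem tc_X (n m k : ℕ) (i : Fin 3) : tc (X n m k) i = 0 := X_apply_r ..
theorem tc_Y (n m k : ℕ) (i : Fin 3) : tc (Y n m k) i = 0 := Y_apply_t ..
theorem xc_T (n m k i : ℕ) : xc (T n m k) i = 0 := by
  unfold xc T; split_ifs <;> simp
theorem yc_T (n m k i : ℕ) : yc (T n m k) i = 0 := by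
  unfold yc T; split_ifs <;> simp
theorem tc_T1 (n m : ℕ) (i : Fin 3) : tc (T n m 1) i = if i = 0 then 1 else 0 := by
  unfold tc; rw [T_one]; fin_cases i <;> simp
theorem tc_T2 (n m : ℕ) (i : Fin 3) : tc (T n m 2) i = if i = 1 then 1 else 0 := by
  unfold tc; rw [T_two]; fin_cases i <;> simp
theorem tc_T3 (n m : ℕ) (i : Fin 3) : tc (T n m 3) i = if i = 2 then 1 else 0 := by
  unfold tc; rw [T_three]; fin_cases i <;> simp

theorem xc_big {n m : ℕ} (u : V n m) (i : ℕ) (h : n ≤ i) : xc u i = 0 := by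
  unfold xc; rw [dif_neg]; omega
theorem yc_big {n m : ℕ} (u : V n m) (i : ℕ) (h : m ≤ i) : yc u i = 0 := by
  unfold yc; rw [dif_neg]; omega

theorem v_ext {n m : ℕ} {u v : V n m} (hx : ∀ i < n, xc u i = xc v i)
    (ht : ∀ i, tc u i = tc v i) (hy : ∀ i < m, yc u i = yc v i) : u = v := by
  ext a
  rcases a with i | s | j
  · have := hx i i.2
    simpa [xc] using this
  · exact ht s
  · have := hy j j.2
    simpa [yc] using this

/-- Induction over vectors from basis vectors. -/
theorem v_ind {n m : ℕ} (P : V n m → Prop) (h0 : P 0) (hadd : ∀ u v, P u → P v → P (u + v))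
    (hsmul : ∀ (r : ℂ) u, P u → P (r • u))
    (hb : ∀ a, P (Finsupp.single a 1)) (u : V n m) : P u := by
  induction u using Finsupp.induction_linear with
  | zero => exact h0
  | add f g hf hg => exact hadd f g hf hg
  | single a r =>
    have := hsmul r _ (hb a)
    simpa using this

theorem xc_single_x {n m : ℕ} (k : Fin n) (i : ℕ) :
    xc (Finsupp.single (Sum.inl k) 1 : V n m) i = if k.val = i then 1 else 0 := by
  rw [← X_succ n m k.val k.2, xc_X]
  have := k.2
  congr 1
  apply propext
  omega
theorem yc_single_x {n m : ℕ} (k : Fin n) (i : ℕ) :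
    yc (Finsupp.single (Sum.inl k) 1 : V n m) i = 0 := by
  rw [← X_succ n m k.val k.2, yc_X]
theorem tc_single_x {n m : ℕ} (k : Fin n) (i : Fin 3) :
    tc (Finsupp.single (Sum.inl k) 1 : V n m) i = 0 := by
  rw [← X_succ n m k.val k.2, tc_X]
theorem yc_single_y {n m : ℕ} (k : Fin m) (i : ℕ) :
    yc (Finsupp.single (Sum.inr (Sum.inr k)) 1 : V n m) i = if k.val = i then 1 else 0 := by
  rw [← Y_succ n m k.val k.2, yc_Y]
  have := k.2
  congr 1
  apply propext
  omega
theorem xc_single_y {n m : ℕ} (k : Fin m) (i : ℕ) :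
    xc (Finsupp.single (Sum.inr (Sum.inr k)) 1 : V n m) i = 0 := by
  rw [← Y_succ n m k.val k.2, xc_Y]
theorem tc_single_y {n m : ℕ} (k : Fin m) (i : Fin 3) :
    tc (Finsupp.single (Sum.inr (Sum.inr k)) 1 : V n m) i = 0 := by
  rw [← Y_succ n m k.val k.2, tc_Y]
theorem xc_single_t {n m : ℕ} (k : Fin 3) (i : ℕ) :
    xc (Finsupp.single (Sum.inr (Sum.inl k)) 1 : V n m) i = 0 := by
  unfold xc; split_ifs <;> simp
theorem yc_single_t {n m : ℕ} (k : Fin 3) (i : ℕ) :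
    yc (Finsupp.single (Sum.inr (Sum.inl k)) 1 : V n m) i = 0 := by
  unfold yc; split_ifs <;> simp
theorem tc_single_t {n m : ℕ} (k : Fin 3) (i : Fin 3) :
    tc (Finsupp.single (Sum.inr (Sum.inl k)) 1 : V n m) i = if k = i then 1 else 0 := by
  unfold tc; rw [Finsupp.single_apply]; simp

/-- bilinear induction -/
theorem v_ind2 {n m : ℕ} (f : V n m → V n m → ℂ) (g : V n m → V n m → ℂ)
    (f1 : ∀ u u' v, f (u + u') v = f u v + f u' v) (f2 : ∀ (r : ℂ) u v, f (r • u) v = r * f u v)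
    (f3 : ∀ u v v', f u (v + v') = f u v + f u v') (f4 : ∀ (r : ℂ) u v, f u (r • v) = r * f u v)
    (g1 : ∀ u u' v, g (u + u') v = g u v + g u' v) (g2 : ∀ (r : ℂ) u v, g (r • u) v = r * g u v)
    (g3 : ∀ u v v', g u (v + v') = g u v + g u v') (g4 : ∀ (r : ℂ) u v, g u (r • v) = r * g u v)
    (hb : ∀ a b, f (Finsupp.single a 1) (Finsupp.single b 1) =
      g (Finsupp.single a 1) (Finsupp.single b 1)) (u v : V n m) : f u v = g u v := by
  induction u using v_ind with
  | h0 =>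
    have a := f2 0 0 v
    have b := g2 0 0 v
    simp at a b
    rw [a, b]
  | hadd u u' h h' => rw [f1, g1, h, h']
  | hsmul r u h => rw [f2, g2, h]
  | hb a =>
    induction v using v_ind with
    | h0 =>
      have h := f4 0 (Finsupp.single a 1) 0
      have h' := g4 0 (Finsupp.single a 1) 0
      simp at h h'
      rw [h, h']
    | hadd u u' h h' => rw [f3, g3, h, h']
    | hsmul r u h => rw [f4, g4, h]
    | hb b => exact hb a b

theorem xc_br {n m : ℕ} (hn : 3 ≤ n) (u v : V n m) (i : ℕ) (hi : i < n) :
    xc (br n m u v) i =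
      if i = 0 then xc u 0 * tc v 0 - tc u 0 * xc v 0
      else (if i = 1 then 0 else xc u (i - 1) * xc v 0) +
        ((i : ℂ) - 1) * (xc u i * tc v 0) + xc u i * tc v 1 := by
  revert u v
  apply v_ind2 (fun u v => xc (br n m u v) i) (fun u v => if i = 0 then xc u 0 * tc v 0 - tc u 0 * xc v 0
      else (if i = 1 then 0 else xc u (i - 1) * xc v 0) +
        ((i : ℂ) - 1) * (xc u i * tc v 0) + xc u i * tc v 1)
  · intros; simp only [br_add_left, xc_add]
  · intros; simp only [br_smul_left, xc_smul]
  · intros; simp only [br_add_right, xc_add]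
  · intros; simp only [br_smul_right, xc_smul]
  · intros; simp only [xc_add, tc_add]; split_ifs <;> ring
  · intros; simp only [xc_smul, tc_smul]; split_ifs <;> ring
  · intros; simp only [xc_add, tc_add]; split_ifs <;> ring
  · intros; simp only [xc_smul, tc_smul]; split_ifs <;> ring
  · intro a b
    simp only [br_single, mul_one, one_smul]
    rcases a with k | s | k <;> rcases b with l | s' | l <;>
      simp only [xc_single_x, xc_single_y, xc_single_t, tc_single_x, tc_single_y, tc_single_t, c,
        mul_zero, zero_mul, add_zero, zero_add, sub_zero, ite_self, xc_zero]
    · rcases k with ⟨k, hk⟩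
      rcases l with ⟨l, hl⟩
      dsimp only
      split_ifs <;> simp only [xc_X, xc_zero] <;> grind
    · rcases k with ⟨k, hk⟩
      fin_cases s'
      · rcases k with _ | k
        · rcases i with _ | i <;> simp [xc_X]
          omega
        · rcases i with _ | i
          · simp [xc_smul, xc_X]
          · by_cases h : k = i
            · subst h; simp [xc_smul, xc_X, hi]
            · simp [h, xc_smul, xc_X]
      · simp
        split_ifs <;> simp_all [xc_X, xc_zero] <;> omega
      · simp [xc_zero]
    · rcases l with ⟨l, hl⟩
      fin_cases s
      · simp
        split_ifs <;> simp_all [xc_X, xc_zero, xc_neg]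
      · simp [xc_zero]
      · simp [xc_zero]
    · split_ifs <;> simp [xc_Y, xc_zero]
    · split_ifs <;> simp [xc_Y, xc_zero, xc_smul]

theorem yc_br {n m : ℕ} (u v : V n m) (i : ℕ) (hi : i < m) :
    yc (br n m u v) i =
      (if i = 0 then 0 else yc u (i - 1) * xc v 0) +
        (i : ℂ) * (yc u i * tc v 0) + yc u i * tc v 2 := by
  revert u v
  apply v_ind2 (fun u v => yc (br n m u v) i) (fun u v => (if i = 0 then 0 else yc u (i - 1) * xc v 0) +
        (i : ℂ) * (yc u i * tc v 0) + yc u i * tc v 2)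
  · intros; simp only [br_add_left, yc_add]
  · intros; simp only [br_smul_left, yc_smul]
  · intros; simp only [br_add_right, yc_add]
  · intros; simp only [br_smul_right, yc_smul]
  · intros; simp only [yc_add]; split_ifs <;> ring
  · intros; simp only [yc_smul]; split_ifs <;> ring
  · intros; simp only [xc_add, tc_add]; split_ifs <;> ring
  · intros; simp only [xc_smul, tc_smul]; split_ifs <;> ring
  · intro a b
    simp only [br_single, mul_one, one_smul]
    rcases a with k | s | k <;> rcases b with l | s' | l <;>
      simp only [xc_single_x, xc_single_y, xc_single_t, yc_single_x, yc_single_y, yc_single_t,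
        tc_single_x, tc_single_y, tc_single_t, c,
        mul_zero, zero_mul, add_zero, zero_add, sub_zero, ite_self, yc_zero]
    · split_ifs <;> simp [yc_X, yc_zero]
    · split_ifs <;> simp [yc_X, yc_zero, yc_smul]
    · split_ifs <;> simp [yc_X, yc_zero, yc_neg]
    · rcases k with ⟨k, hk⟩
      rcases l with ⟨l, hl⟩
      dsimp only
      split_ifs <;> simp only [yc_Y, yc_zero] <;> grind
    · rcases k with ⟨k, hk⟩
      fin_cases s'
      · by_cases h : k = i
        · subst h; simp [yc_smul, yc_Y, hi]
        · simp [h, yc_smul, yc_Y]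
      · simp [yc_zero]
      · by_cases h : k = i
        · subst h; simp [yc_Y, hi]
        · simp [h, yc_Y]

theorem tc_br {n m : ℕ} (u v : V n m) (i : Fin 3) : tc (br n m u v) i = 0 := by
  revert u v
  apply v_ind2 (fun u v => tc (br n m u v) i) (fun u v => 0)
  · intros; simp only [br_add_left, tc_add]
  · intros; simp only [br_smul_left, tc_smul]
  · intros; simp only [br_add_right, tc_add]
  · intros; simp only [br_smul_right, tc_smul]
  · intros; simp
  · intros; simp
  · intros; simp
  · intros; simp
  · intro a b
    simp only [br_single, mul_one, one_smul]
    rcases a with k | s | k <;> rcases b with l | s' | l <;> simp only [c] <;> (try split_ifs) <;>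
      simp [tc_zero, tc_X, tc_Y, tc_smul, tc_neg]

theorem homog_zero {n m : ℕ} (u : V n m) : IsHomog n m u 0 ↔ ∀ j < m, yc u j = 0 := by
  constructor
  · intro h j hj
    by_contra hne
    have := h (Sum.inr (Sum.inr ⟨j, hj⟩)) (by simpa [yc, hj] using hne)
    simp [par] at this
  · intro h a ha
    rcases a with i | s | j
    · rfl
    · rfl
    · exfalso
      have := h j j.2
      simp [yc] at this
      simp [this] at ha

theorem homog_one {n m : ℕ} (u : V n m) :
    IsHomog n m u 1 ↔ (∀ j < n, xc u j = 0) ∧ ∀ s, tc u s = 0 := by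
  constructor
  · intro h
    constructor
    · intro j hj
      by_contra hne
      have := h (Sum.inl ⟨j, hj⟩) (by simpa [xc, hj] using hne)
      simp [par] at this
    · intro s
      by_contra hne
      have := h (Sum.inr (Sum.inl s)) (by simpa [tc] using hne)
      simp [par] at this
  · rintro ⟨h, h'⟩ a ha
    rcases a with i | s | j
    · exfalso
      have := h i i.2
      simp [xc] at this
      simp [this] at ha
    · exfalso
      have := h' s
      simp [tc] at this
      simp [this] at ha
    · rfl

theorem leibniz {n m : ℕ} (hn : 3 ≤ n) (u v z : V n m) :
    br n m (br n m u v) z = br n m (br n m u z) v + br n m u (br n m v z) := by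
  apply v_ext
  · intro i hi
    rcases i with _ | _ | _ | i
    · simp only [xc_add, xc_br hn _ _ _ hi, tc_br]; simp; ring
    · simp only [xc_add, xc_br hn _ _ _ hi, xc_br hn _ _ 0 (by omega), tc_br]; simp; ring
    · simp only [xc_add, xc_br hn _ _ _ hi, xc_br hn _ _ 0 (by omega),
        xc_br hn _ _ 1 (by omega), tc_br, Nat.add_sub_cancel]; simp
      ring
    · simp only [xc_add, xc_br hn _ _ _ hi, xc_br hn _ _ 0 (by omega), tc_br,
        Nat.add_sub_cancel]; simp
      simp only [xc_br hn _ _ (i + 2) (by omega)]; simp; ring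
  · intro i
    simp [tc_add, tc_br]
  · intro i hi
    rcases i with _ | i
    · simp only [yc_add, yc_br _ _ _ hi, tc_br, xc_br hn _ _ 0 (by omega)]; simp; ring
    · simp only [yc_add, yc_br _ _ _ hi, tc_br, xc_br hn _ _ 0 (by omega),
        Nat.add_sub_cancel]; simp
      simp only [yc_br (n := n) (m := m) _ _ i (by omega)]
      rcases i with _ | i
      · simp; ring
      · simp; ring

theorem Rm_even {n m : ℕ} (hn : 3 ≤ n) (z : V n m) :
    IsEvenDer n m (Rm n m z) := by
  refine ⟨?_, fun u v => leibniz hn u v z⟩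
  intro u s h
  change IsHomog n m (br n m u z) s
  have hs : s = 0 ∨ s = 1 := by
    clear h; revert s; decide
  rcases hs with rfl | rfl
  · rw [homog_zero] at h ⊢
    intro j hj
    rw [yc_br _ _ _ hj, h j hj]
    split_ifs
    · simp
    · simp [h (j - 1) (by omega)]
  · rw [homog_one] at h ⊢
    obtain ⟨h1, h2⟩ := h
    refine ⟨?_, fun s => tc_br _ _ _⟩
    intro j hj
    rw [xc_br hn _ _ _ hj, h1 j hj, h1 0 (by omega), h2, h1 (j - 1) (by omega)]
    simp

section table
variable {n m : ℕ}

theorem br_T2 (v : V n m) (hn : 3 ≤ n) : br n m (T n m 2) v = 0 := by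
  apply v_ext
  · intro i hi
    simp [xc_br hn _ _ _ hi, xc_T, tc_T2, xc_zero]
  · intro i; simp [tc_br, tc_zero]
  · intro i hi
    simp [yc_br _ _ _ hi, yc_T, yc_zero]
theorem br_T3 (v : V n m) (hn : 3 ≤ n) : br n m (T n m 3) v = 0 := by
  apply v_ext
  · intro i hi
    simp [xc_br hn _ _ _ hi, xc_T, tc_T3, xc_zero]
  · intro i; simp [tc_br, tc_zero]
  · intro i hi
    simp [yc_br _ _ _ hi, yc_T, yc_zero]
theorem br_T1 (v : V n m) (hn : 3 ≤ n) : br n m (T n m 1) v = - (xc v 0) • X n m 1 := by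
  apply v_ext
  · intro i hi
    rcases i with _ | i <;> simp [xc_br hn _ _ _ hi, xc_T, tc_T1, xc_smul, xc_X, xc_neg]
    omega
  · intro i; simp [tc_br, tc_neg, tc_smul, tc_X]
  · intro i hi
    simp [yc_br _ _ _ hi, yc_T, yc_smul, yc_X, yc_neg]
theorem br_X1 (v : V n m) (hn : 3 ≤ n) : br n m (X n m 1) v = (tc v 0) • X n m 1 := by
  apply v_ext
  · intro i hi
    rcases i with _ | _ | _ | i <;>
      simp [xc_br hn _ _ _ hi, xc_smul, xc_X, tc_X]
  · intro i; simp [tc_br, tc_smul, tc_X]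
  · intro i hi
    simp [yc_br _ _ _ hi, yc_X, yc_smul]
theorem br_X (k : ℕ) (v : V n m) (hn : 3 ≤ n) : br n m (X n m (k + 2)) v =
    (xc v 0) • X n m (k + 3) + (k * tc v 0 + tc v 1) • X n m (k + 2) := by
  apply v_ext
  · intro i hi
    rcases i with _ | _ | i
    · simp [xc_br hn _ _ _ hi, xc_smul, xc_X, tc_X, xc_add]
    · simp [xc_br hn _ _ _ hi, xc_smul, xc_X, tc_X, xc_add, hi]
      by_cases h : k = 0
      · subst h; simp
      · simp [h]
    · have h1 : i + 1 < n := by omega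
      simp [xc_br hn _ _ _ hi, xc_smul, xc_X, tc_X, xc_add, hi, h1]
      by_cases h : k = i + 1
      · subst h; simp
      · simp [h]
  · intro i; simp [tc_br, tc_smul, tc_X, tc_add]
  · intro i hi
    simp [yc_br _ _ _ hi, yc_X, yc_smul, yc_add]
theorem br_Y (k : ℕ) (v : V n m) (hn : 3 ≤ n) : br n m (Y n m (k + 1)) v =
    (xc v 0) • Y n m (k + 2) + (k * tc v 0 + tc v 2) • Y n m (k + 1) := by
  apply v_ext
  · intro i hi
    simp [xc_br hn _ _ _ hi, xc_smul, xc_Y, tc_Y, xc_add]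
  · intro i; simp [tc_br, tc_smul, tc_Y, tc_add]
  · intro i hi
    rcases i with _ | i
    · simp [yc_br _ _ _ hi, yc_smul, yc_Y, yc_add, hi]
      by_cases h : k = 0
      · subst h; simp
      · simp [h]
    · have h1 : i < m := by omega
      simp [yc_br _ _ _ hi, yc_smul, yc_Y, yc_add, hi, h1]
      by_cases h : k = i + 1
      · subst h; simp
      · simp [h]

end table

theorem odd_zero {n m : ℕ} (hn : 3 ≤ n) (D : Module.End ℂ (V n m))
    (hD : IsOddDer n m D) : D = 0 := by
  obtain ⟨hp, hd⟩ := hD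
  have hT : IsHomog n m (T n m 3) 0 := by
    rw [homog_zero]; intro j _; exact yc_T ..
  have hDT := hp _ _ hT
  rw [zero_add, homog_one] at hDT
  have key : ∀ u, D (br n m u (T n m 3)) = br n m (D u) (T n m 3) := by
    intro u
    rw [hd u _ 0 hT]
    have : br n m u (D (T n m 3)) = 0 := by
      apply v_ext
      · intro i hi
        simp [xc_br hn _ _ _ hi, hDT.1 0 (by omega), hDT.2, xc_zero]
      · intro i; simp [tc_br, tc_zero]
      · intro i hi
        simp [yc_br _ _ _ hi, hDT.1 0 (by omega), hDT.2, yc_zero]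
    simp [this]
  have ev : ∀ u, IsHomog n m u 0 → D u = 0 := by
    intro u hu
    have h1 := hp _ _ hu
    rw [homog_zero] at hu
    rw [zero_add, homog_one] at h1
    have h2 := key u
    have h3 : br n m u (T n m 3) = 0 := by
      apply v_ext
      · intro i hi
        simp [xc_br hn _ _ _ hi, xc_T, tc_T3, xc_zero]
      · intro i; simp [tc_br, tc_zero]
      · intro i hi
        simp [yc_br _ _ _ hi, xc_T, tc_T3, yc_zero, hu i hi]
    rw [h3, map_zero] at h2
    apply v_ext
    · intro i hi; rw [h1.1 i hi, xc_zero]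
    · intro i; rw [h1.2, tc_zero]
    · intro i hi
      have := congrArg (fun w => yc w i) h2
      simp [yc_br _ _ _ hi, xc_T, tc_T3, yc_zero] at this
      rw [← this, yc_zero]
  have od : ∀ u, IsHomog n m u 1 → D u = 0 := by
    intro u hu
    have h1 := hp _ _ hu
    rw [homog_one] at hu
    rw [show (1 : ZMod 2) + 1 = 0 from rfl, homog_zero] at h1
    have h2 := key u
    have h3 : br n m u (T n m 3) = u := by
      apply v_ext
      · intro i hi
        simp [xc_br hn _ _ _ hi, xc_T, tc_T3, hu.1 i hi]
      · intro i; simp [tc_br, hu.2]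
      · intro i hi
        simp [yc_br _ _ _ hi, xc_T, tc_T3]
    rw [h3] at h2
    rw [h2]
    apply v_ext
    · intro i hi
      simp [xc_br hn _ _ _ hi, xc_T, tc_T3, xc_zero]
    · intro i; simp [tc_br, tc_zero]
    · intro i hi
      simp [yc_br _ _ _ hi, xc_T, tc_T3, yc_zero, h1 i hi]
  apply lin_ext
  · intro i; exact ev _ ((homog_zero _).2 fun j _ => yc_X ..)
  · exact ev _ ((homog_zero _).2 fun j _ => yc_T ..)
  · exact ev _ ((homog_zero _).2 fun j _ => yc_T ..)
  · exact ev _ ((homog_zero _).2 fun j _ => yc_T ..)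
  · intro i; exact od _ ((homog_one _).2 ⟨fun j _ => xc_Y .., fun s => tc_Y ..⟩)

theorem left_ann {n m : ℕ} (hn : 3 ≤ n) (w : V n m) (hw : ∀ v, br n m w v = 0) :
    (∀ i < n, xc w i = 0) ∧ tc w 0 = 0 := by
  refine ⟨?_, ?_⟩
  · intro i hi
    rcases i with _ | i
    · have := congrArg (fun w => xc w 0) (hw (T n m 1))
      simpa [xc_br hn _ _ _ hi, xc_T, tc_T1, xc_zero] using this
    · have := congrArg (fun w => xc w (i + 1)) (hw (T n m 2))
      simpa [xc_br hn _ _ _ hi, xc_T, tc_T2, xc_zero] using this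
  · have := congrArg (fun w => xc w 0) (hw (X n m 1))
    have h0 : 0 < n := by omega
    simpa [xc_br hn _ _ 0 h0, xc_X, tc_X, xc_zero, h0] using this

theorem Rm_apply (n m : ℕ) (z w : V n m) : Rm n m z w = br n m w z := rfl

set_option maxHeartbeats 1000000 in
theorem even_inner {n m : ℕ} (hn : 3 ≤ n) (hm : 2 ≤ m) (D : Module.End ℂ (V n m))
    (hD : IsEvenDer n m D) : ∃ α β γ δ : ℂ, ∀ w, D w =
      br n m w ((-γ) • X n m 1 + α • T n m 1 + β • T n m 2 + δ • T n m 3) := by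
  obtain ⟨hp, hd⟩ := hD
  have hn0 : 0 < n := by omega
  have hn1 : 1 < n := by omega
  have hm0 : 0 < m := by omega
  have yX : ∀ k, ∀ j < m, yc (D (X n m k)) j = 0 := fun k =>
    (homog_zero _).1 (hp _ _ ((homog_zero _).2 fun j _ => yc_X ..))
  have yT : ∀ k, ∀ j < m, yc (D (T n m k)) j = 0 := fun k =>
    (homog_zero _).1 (hp _ _ ((homog_zero _).2 fun j _ => yc_T ..))
  have xtY : ∀ k, (∀ i < n, xc (D (Y n m k)) i = 0) ∧ ∀ s, tc (D (Y n m k)) s = 0 := fun k =>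
    (homog_one _).1 (hp _ _ ((homog_one _).2 ⟨fun j _ => xc_Y .., fun s => tc_Y ..⟩))
  -- t_2 and t_3
  have a2 := left_ann hn (D (T n m 2)) (fun v => by
    have := hd (T n m 2) v
    rw [br_T2 _ hn, br_T2 _ hn] at this
    simpa using this.symm)
  have a3 := left_ann hn (D (T n m 3)) (fun v => by
    have := hd (T n m 3) v
    rw [br_T3 _ hn, br_T3 _ hn] at this
    simpa using this.symm)
  have p22 : tc (D (T n m 2)) 1 = 0 := by
    have h := hd (X n m 2) (T n m 2)
    rw [br_X 0 _ hn, br_X 0 _ hn] at h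
    have h' := congrArg (fun w => xc w 1) h
    simpa [xc_T, tc_T2, xc_add, xc_smul, xc_neg, xc_br hn _ _ 1 hn1, xc_X, hn1] using h'
  have p32 : tc (D (T n m 3)) 1 = 0 := by
    have h := hd (X n m 2) (T n m 3)
    rw [br_X 0 _ hn, br_X 0 _ hn] at h
    have h' := congrArg (fun w => xc w 1) h
    simpa [xc_T, tc_T3, xc_add, xc_smul, xc_neg, xc_br hn _ _ 1 hn1, xc_X, hn1, xc_zero] using h'.symm
  have p23 : tc (D (T n m 2)) 2 = 0 := by
    have h := hd (Y n m 1) (T n m 2)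
    rw [br_Y 0 _ hn, br_Y 0 _ hn] at h
    have h' := congrArg (fun w => yc w 0) h
    simpa [xc_T, tc_T2, yc_add, yc_smul, yc_neg, yc_br _ _ 0 hm0, yc_Y, hm0, yc_zero] using h'.symm
  have p33 : tc (D (T n m 3)) 2 = 0 := by
    have h := hd (Y n m 1) (T n m 3)
    rw [br_Y 0 _ hn, br_Y 0 _ hn] at h
    have h' := congrArg (fun w => yc w 0) h
    simpa [xc_T, tc_T3, yc_add, yc_smul, yc_neg, yc_br _ _ 0 hm0, yc_Y, hm0, yc_zero] using h'
  have DT2 : D (T n m 2) = 0 := by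
    apply v_ext
    · intro i hi; rw [a2.1 i hi, xc_zero]
    · intro i
      fin_cases i
      · exact a2.2
      · exact p22
      · exact p23
    · intro i hi; rw [yT _ i hi, yc_zero]
  have DT3 : D (T n m 3) = 0 := by
    apply v_ext
    · intro i hi; rw [a3.1 i hi, xc_zero]
    · intro i
      fin_cases i
      · exact a3.2
      · exact p32
      · exact p33
    · intro i hi; rw [yT _ i hi, yc_zero]
  -- t_1 and x_1
  have q1 : ∀ i, i + 1 < n → xc (D (T n m 1)) (i + 1) = 0 := by
    intro i hi
    have h := hd (T n m 1) (T n m 2)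
    rw [DT2, br_T1 _ hn, br_zero_right] at h
    have h' := congrArg (fun w => xc w (i + 1)) h
    simpa [xc_T, tc_T2, xc_br hn _ _ _ hi, xc_zero] using h'.symm
  have hx1 := hd (X n m 1) (T n m 1)
  rw [br_X1 _ hn, br_X1 _ hn] at hx1
  have t10 : tc (D (T n m 1)) 0 = 0 := by
    have h' := congrArg (fun w => xc w 0) hx1
    simpa [xc_T, tc_T1, xc_add, xc_smul, xc_neg, xc_br hn _ _ 0 hn0, xc_X, hn0] using h'
  have DX1 : D (X n m 1) = xc (D (X n m 1)) 0 • X n m 1 := by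
    apply v_ext
    · intro i hi
      rcases i with _ | i
      · simp [xc_smul, xc_neg, xc_X, hn0]
      · have h := hd (X n m 1) (T n m 2)
        rw [DT2, br_X1 _ hn, br_zero_right] at h
        have h' := congrArg (fun w => xc w (i + 1)) h
        simpa [xc_T, tc_T2, xc_br hn _ _ _ hi, xc_zero, xc_smul, xc_neg, xc_X] using h'.symm
    · intro i
      have h' := congrArg (fun w => tc w i) hx1
      simpa [tc_T1, tc_add, tc_smul, tc_neg, tc_br, tc_X] using h'
    · intro i hi; rw [yX _ i hi]; simp [yc_smul, yc_neg, yc_X]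
  -- x_2
  have hx2 := hd (X n m 2) (T n m 1)
  rw [br_X 0 _ hn, br_X 0 _ hn] at hx2
  have t11 : tc (D (T n m 1)) 1 = 0 := by
    have h' := congrArg (fun w => xc w 1) hx2
    simpa [xc_T, tc_T1, xc_add, xc_smul, xc_neg, xc_br hn _ _ 1 hn1, xc_X, hn1, xc_zero] using h'.symm
  have hy1 := hd (Y n m 1) (T n m 1)
  rw [br_Y 0 _ hn, br_Y 0 _ hn] at hy1
  have t12 : tc (D (T n m 1)) 2 = 0 := by
    have h' := congrArg (fun w => yc w 0) hy1
    simpa [xc_T, tc_T1, yc_add, yc_smul, yc_neg, yc_br _ _ 0 hm0, yc_Y, hm0, yc_zero] using h'.symm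
  have DT1 : D (T n m 1) = xc (D (T n m 1)) 0 • X n m 1 := by
    apply v_ext
    · intro i hi
      rcases i with _ | i
      · simp [xc_smul, xc_neg, xc_X, hn0]
      · rw [q1 i hi]; simp [xc_smul, xc_neg, xc_X]
    · intro i
      rw [tc_smul, tc_X, mul_zero]
      fin_cases i
      · exact t10
      · exact t11
      · exact t12
    · intro i hi; rw [yT _ i hi]; simp [yc_smul, yc_neg, yc_X]
  have DX2 : D (X n m 2) = xc (D (X n m 2)) 1 • X n m 2
      + (-xc (D (T n m 1)) 0) • X n m 3 := by
    apply v_ext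
    · intro i hi
      have h' := congrArg (fun w => xc w i) hx2
      rcases i with _ | _ | _ | i
      · simp [xc_T, tc_T1, xc_add, xc_smul, xc_neg, xc_br hn _ _ _ hi, xc_X, xc_zero] at h'
        rw [← h']; simp [xc_add, xc_smul, xc_neg, xc_X]
      · simp [xc_add, xc_smul, xc_neg, xc_X, hn1]
      · simp [xc_T, tc_T1, xc_add, xc_smul, xc_neg, xc_br hn _ _ _ hi, xc_X, xc_zero, t11] at h'
        have hi' : 2 < n := hi
        simp [hi'] at h'
        simp [xc_add, xc_smul, xc_neg, xc_X, hi']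
        linear_combination -h'
      · simp [xc_T, tc_T1, xc_add, xc_smul, xc_neg, xc_br hn _ _ _ hi, xc_X, xc_zero, t11] at h'
        simp [xc_add, xc_smul, xc_neg, xc_X]
        rcases h' with h' | h'
        · exfalso
          have : ((i + 2 : ℕ) : ℂ) = 0 := by push_cast; linear_combination h'
          have := Nat.cast_eq_zero.1 this
          omega
        · exact h'
    · intro i
      have h := hd (X n m 2) (T n m 2)
      rw [DT2, br_X 0 _ hn, br_zero_right] at h
      have h' := congrArg (fun w => tc w i) h
      simpa [xc_T, tc_T2, tc_add, tc_smul, tc_neg, tc_br, tc_X] using h'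
    · intro i hi; rw [yX _ i hi]; simp [yc_smul, yc_neg, yc_X, yc_add]
  have DY1 : D (Y n m 1) = yc (D (Y n m 1)) 0 • Y n m 1
      + (-xc (D (T n m 1)) 0) • Y n m 2 := by
    apply v_ext
    · intro i hi
      rw [(xtY 1).1 i hi]; simp [xc_add, xc_smul, xc_neg, xc_Y]
    · intro i
      rw [(xtY 1).2 i]; simp [tc_add, tc_smul, tc_neg, tc_Y]
    · intro i hi
      have h' := congrArg (fun w => yc w i) hy1
      rcases i with _ | _ | i
      · simp [yc_add, yc_smul, yc_neg, yc_Y, hm0]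
      · have hi' : 1 < m := hi
        simp [xc_T, tc_T1, yc_add, yc_smul, yc_neg, yc_br _ _ _ hi, yc_Y, yc_zero, t12, hi'] at h'
        simp [yc_add, yc_smul, yc_neg, yc_Y, hi']
        linear_combination -h'
      · simp [xc_T, tc_T1, yc_add, yc_smul, yc_neg, yc_br _ _ _ hi, yc_Y, yc_zero, t12] at h'
        simp [yc_add, yc_smul, yc_neg, yc_Y]
        rcases h' with h' | h'
        · exfalso
          have : ((i + 2 : ℕ) : ℂ) = 0 := by push_cast; linear_combination h'
          have := Nat.cast_eq_zero.1 this
          omega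
        · exact h'
  generalize hα : xc (D (X n m 1)) 0 = α at *
  generalize hβ : xc (D (X n m 2)) 1 = β at *
  generalize hγ : xc (D (T n m 1)) 0 = γ at *
  generalize hδ : yc (D (Y n m 1)) 0 = δ at *
  refine ⟨α, β, γ, δ, ?_⟩
  generalize hz : (-γ) • X n m 1 + α • T n m 1 + β • T n m 2 + δ • T n m 3 = z
  have z0 : xc z 0 = -γ := by
    rw [← hz]; simp [xc_add, xc_smul, xc_neg, xc_X, xc_T, hn0]
  have zt0 : tc z 0 = α := by
    rw [← hz]; simp [tc_add, tc_smul, tc_neg, tc_X, tc_T1, tc_T2, tc_T3]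
  have zt1 : tc z 1 = β := by
    rw [← hz]; simp [tc_add, tc_smul, tc_neg, tc_X, tc_T1, tc_T2, tc_T3]
  have zt2 : tc z 2 = δ := by
    rw [← hz]; simp [tc_add, tc_smul, tc_neg, tc_X, tc_T1, tc_T2, tc_T3]
  have eX1 : D (X n m 1) = br n m (X n m 1) z := by rw [DX1, br_X1 _ hn, zt0]
  have step : ∀ w, D w = br n m w z →
      D (br n m w (X n m 1)) = br n m (br n m w (X n m 1)) z := by
    intro w hw
    rw [hd, leibniz hn, hw, eX1]
  have eX : ∀ k, D (X n m (k + 2)) = br n m (X n m (k + 2)) z := by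
    intro k
    induction k with
    | zero =>
      rw [br_X 0 _ hn, z0, zt0, zt1, DX2]
      simp [add_comm]
    | succ k ih =>
      have h := step _ ih
      have e : br n m (X n m (k + 2)) (X n m 1) = X n m (k + 1 + 2) := by
        rw [br_X _ _ hn]; simp [xc_X, tc_X, hn0]
      rwa [e] at h
  have eY : ∀ k, D (Y n m (k + 1)) = br n m (Y n m (k + 1)) z := by
    intro k
    induction k with
    | zero =>
      rw [br_Y 0 _ hn, z0, zt0, zt2, DY1]
      simp [add_comm]
    | succ k ih =>
      have h := step _ ih
      have e : br n m (Y n m (k + 1)) (X n m 1) = Y n m (k + 1 + 1) := by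
        rw [br_Y _ _ hn]; simp [xc_X, tc_X, hn0]
      rwa [e] at h
  have : D = Rm n m z := by
    apply lin_ext
    · rintro ⟨i, hi⟩
      rw [Rm_apply]
      rcases i with _ | i
      · exact eX1
      · have e : i + 1 + 1 = i + 2 := rfl
        dsimp only
        rw [e]
        exact eX i
    · rw [Rm_apply, DT1, br_T1 _ hn, z0, neg_neg]
    · rw [Rm_apply, DT2, br_T2 _ hn]
    · rw [Rm_apply, DT3, br_T3 _ hn]
    · intro j
      rw [Rm_apply]
      exact eY j
  intro w
  rw [this, Rm_apply]

/-- Every superderivation of `SLP^{n,m}` is even, every even superderivation has the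
displayed form and equals `-γ R_{x_1} + α R_{t_1} + β R_{t_2} + δ R_{t_3}`, so every
superderivation is inner and `dim Der(SLP^{n,m}) = 4`. -/
theorem superderivations_SLP (n m : ℕ) (hn : 3 ≤ n) (hm : 2 ≤ m) :
    (∀ D : Module.End ℂ (V n m), IsOddDer n m D → D = 0) ∧
    (∀ D : Module.End ℂ (V n m), IsEvenDer n m D →
      ∃ α β γ δ : ℂ,
        D (X n m 1) = α • X n m 1 ∧
        (∀ i : ℕ, 2 ≤ i → i ≤ n →
          D (X n m i) = (β + ((i : ℂ) - 2) * α) • X n m i - γ • X n m (i + 1)) ∧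
        D (T n m 1) = γ • X n m 1 ∧ D (T n m 2) = 0 ∧ D (T n m 3) = 0 ∧
        D (Y n m 1) = δ • Y n m 1 - γ • Y n m 2 ∧
        (∀ j : ℕ, 2 ≤ j → j ≤ m →
          D (Y n m j) = (δ + ((j : ℂ) - 1) * α) • Y n m j - γ • Y n m (j + 1)) ∧
        (∀ w : V n m,
          D w = -(γ • br n m w (X n m 1)) + α • br n m w (T n m 1)
            + β • br n m w (T n m 2) + δ • br n m w (T n m 3))) ∧
    (∃ B : Fin 4 → Module.End ℂ (V n m),
      LinearIndependent ℂ B ∧ (∀ i, IsEvenDer n m (B i)) ∧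
      ∀ D : Module.End ℂ (V n m), IsEvenDer n m D → D ∈ Submodule.span ℂ (Set.range B)) := by
  have hn0 : 0 < n := by omega
  have hn1 : 1 < n := by omega
  have hm0 : 0 < m := by omega
  refine ⟨fun D hD => odd_zero hn D hD, ?_, ?_⟩
  · intro D hD
    obtain ⟨α, β, γ, δ, h⟩ := even_inner hn hm D hD
    refine ⟨α, β, γ, δ, ?_, ?_, ?_, ?_, ?_, ?_, ?_, ?_⟩
    · rw [h, br_X1 _ hn]
      simp [tc_add, tc_smul, tc_neg, tc_X, tc_T1, tc_T2, tc_T3]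
    · intro i hi _
      obtain ⟨k, rfl⟩ : ∃ k, i = k + 2 := ⟨i - 2, by omega⟩
      rw [h, br_X _ _ hn]
      simp [tc_add, tc_smul, tc_neg, tc_X, tc_T1, tc_T2, tc_T3, xc_add, xc_smul, xc_neg, xc_X, xc_T, hn0]
      module
    · rw [h, br_T1 _ hn]
      simp [xc_add, xc_smul, xc_neg, xc_X, xc_T, hn0]
    · rw [h, br_T2 _ hn]
    · rw [h, br_T3 _ hn]
    · rw [h, br_Y 0 _ hn]
      simp [tc_add, tc_smul, tc_neg, tc_X, tc_T1, tc_T2, tc_T3, xc_add, xc_smul, xc_neg, xc_X, xc_T, hn0]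
      module
    · intro j hj _
      obtain ⟨k, rfl⟩ : ∃ k, j = k + 1 := ⟨j - 1, by omega⟩
      rw [h, br_Y _ _ hn]
      simp [tc_add, tc_smul, tc_neg, tc_X, tc_T1, tc_T2, tc_T3, xc_add, xc_smul, xc_neg, xc_X, xc_T, hn0]
      module
    · intro w
      rw [h]
      simp only [br_add_right, br_smul_right]
      simp only [neg_smul]
  · refine ⟨![Rm n m (X n m 1), Rm n m (T n m 1), Rm n m (T n m 2), Rm n m (T n m 3)],
      ?_, ?_, ?_⟩
    · rw [Fintype.linearIndependent_iffₛ]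
      intro f f' hff i
      suffices hs : ∀ i, (f - f') i = 0 from sub_eq_zero.1 (hs i)
      generalize hgf : f - f' = g
      clear i
      have key : ∀ w, g 0 • br n m w (X n m 1) + g 1 • br n m w (T n m 1)
          + g 2 • br n m w (T n m 2) + g 3 • br n m w (T n m 3) = 0 := by
        intro w
        have := congrArg (fun F : Module.End ℂ (V n m) => F w) hff
        simp only [Fin.sum_univ_four, LinearMap.add_apply, LinearMap.smul_apply] at this
        change f 0 • br n m w (X n m 1) + f 1 • br n m w (T n m 1)
          + f 2 • br n m w (T n m 2) + f 3 • br n m w (T n m 3) =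
          f' 0 • br n m w (X n m 1) + f' 1 • br n m w (T n m 1)
          + f' 2 • br n m w (T n m 2) + f' 3 • br n m w (T n m 3) at this
        rw [← hgf]
        simp only [Pi.sub_apply, sub_smul]
        rw [← sub_eq_zero] at this
        rw [← this]
        abel
      have k0 := congrArg (fun w => xc w 0) (key (T n m 1))
      have k1 := congrArg (fun w => xc w 0) (key (X n m 1))
      have k2 := congrArg (fun w => xc w 1) (key (X n m 2))
      have k3 := congrArg (fun w => yc w 0) (key (Y n m 1))
      simp [br_T1 _ hn, xc_add, xc_smul, xc_neg, xc_X, xc_T, hn0, xc_zero] at k0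
      simp [br_X1 _ hn, xc_add, xc_smul, xc_neg, xc_X, hn0, xc_zero, tc_X, tc_T1, tc_T2, tc_T3] at k1
      simp [br_X 0 _ hn, xc_add, xc_smul, xc_neg, xc_X, xc_T, hn0, hn1, xc_zero, tc_X, tc_T1, tc_T2,
        tc_T3] at k2
      simp [br_Y 0 _ hn, yc_add, yc_smul, yc_Y, xc_X, xc_T, hn0, hm0, yc_zero, tc_X, tc_T1,
        tc_T2, tc_T3] at k3
      intro i
      fin_cases i
      · exact k0
      · exact k1
      · exact k2
      · exact k3
    · intro i
      fin_cases i <;> exact Rm_even hn _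
    · intro D hD
      obtain ⟨α, β, γ, δ, h⟩ := even_inner hn hm D hD
      rw [Submodule.mem_span_range_iff_exists_fun]
      refine ⟨![-γ, α, β, δ], ?_⟩
      apply LinearMap.ext
      intro w
      rw [h]
      simp only [br_add_right, br_smul_right]
      simp [Fin.sum_univ_four, Rm]

end SolvableFiliformLeibniz
end
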